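/- arXiv:0709.4119 — 13 statements merged into one kernel-verified Lean document; each statement's English description precedes it below -/
import Mathlib

section
/- Max of a sum of two quadratic forms: Let n ≥ 1 and let η and α be symmetric real 2n×2n matrices written in n×n block form η = [[η¹¹, η¹²],[ (η¹²)ᵀ, η²²]] and α = [[α¹¹, α¹²],[ (α¹²)ᵀ, α²²]]. Set S = η²² + α¹¹ and assume S is negative definite (so S is invertible). Then for all x, y ∈ ℝⁿ the supremum over z ∈ ℝⁿ of (1/2)(x,z)ᵀ η (x,z) + (1/2)(z,y)ᵀ α (z,y) is attained and equals (1/2)(x,y)ᵀ γ (x,y), where γ is the symmetric 2n×2n matrix with blocks γ¹¹ = η¹¹ − η¹² S⁻¹ (η¹²)ᵀ, γ¹² = −η¹² S⁻¹ α¹², γ²¹ = (γ¹²)ᵀ, and γ²² = α²² − (α¹²)ᵀ S⁻¹ α¹². (This defines the operation γ = η ⊛ α.) -/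
open Matrix

/-- Max of a sum of two quadratic forms: with `η`, `α` symmetric `2n×2n` matrices in
block form and `S = η²² + α¹¹` negative definite, for all `x, y` the supremum over `z`
of `(1/2)(x,z)ᵀη(x,z) + (1/2)(z,y)ᵀα(z,y)` is attained and equals `(1/2)(x,y)ᵀγ(x,y)`
with `γ = η ⊛ α`. -/
theorem max_of_sum_of_quadratics (n : ℕ) (hn : 1 ≤ n)
    (η11 η12 η22 α11 α12 α22 : Matrix (Fin n) (Fin n) ℝ)
    (hη11 : η11.IsSymm) (hη22 : η22.IsSymm) (hα11 : α11.IsSymm) (hα22 : α22.IsSymm)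
    (hS : (-(η22 + α11)).PosDef) :
    ∀ x y : Fin n → ℝ,
      IsGreatest
        (Set.range fun z : Fin n → ℝ =>
          (1 / 2) * (Sum.elim x z ⬝ᵥ (Matrix.fromBlocks η11 η12 η12ᵀ η22) *ᵥ Sum.elim x z) +
          (1 / 2) * (Sum.elim z y ⬝ᵥ (Matrix.fromBlocks α11 α12 α12ᵀ α22) *ᵥ Sum.elim z y))
        ((1 / 2) * (Sum.elim x y ⬝ᵥ
          (Matrix.fromBlocks
            (η11 - η12 * (η22 + α11)⁻¹ * η12ᵀ)
            (-(η12 * (η22 + α11)⁻¹ * α12))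
            (-(η12 * (η22 + α11)⁻¹ * α12))ᵀ
            (α22 - α12ᵀ * (η22 + α11)⁻¹ * α12)) *ᵥ Sum.elim x y)) := by
  intro x y
  have hdet : IsUnit (η22 + α11).det := by
    have h1 := (Matrix.isUnit_iff_isUnit_det _).1 hS.isUnit
    rw [← Matrix.isUnit_iff_isUnit_det] at h1 ⊢
    simpa using h1.neg
  have hSs : (η22 + α11)ᵀ = η22 + α11 := (hη22.add hα11)
  have hTs : ((η22 + α11)⁻¹)ᵀ = (η22 + α11)⁻¹ := by
    rw [Matrix.transpose_nonsing_inv, hSs]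
  have hST : (η22 + α11) * (η22 + α11)⁻¹ = 1 := Matrix.mul_nonsing_inv _ hdet
  have hzS : ∀ z : Fin n → ℝ, z ⬝ᵥ η22 *ᵥ z + z ⬝ᵥ α11 *ᵥ z = z ⬝ᵥ (η22 + α11) *ᵥ z := by
    intro z
    rw [Matrix.add_mulVec, dotProduct_add]
  have adj : ∀ (A : Matrix (Fin n) (Fin n) ℝ) (u v : Fin n → ℝ),
      u ⬝ᵥ A *ᵥ v = (Aᵀ *ᵥ u) ⬝ᵥ v := by
    intro A u v
    rw [Matrix.dotProduct_mulVec, Matrix.mulVec_transpose]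
  have key : ∀ z : Fin n → ℝ,
      (1 / 2) * (Sum.elim x z ⬝ᵥ (Matrix.fromBlocks η11 η12 η12ᵀ η22) *ᵥ Sum.elim x z) +
      (1 / 2) * (Sum.elim z y ⬝ᵥ (Matrix.fromBlocks α11 α12 α12ᵀ α22) *ᵥ Sum.elim z y) =
      (1 / 2) * (Sum.elim x y ⬝ᵥ
          (Matrix.fromBlocks
            (η11 - η12 * (η22 + α11)⁻¹ * η12ᵀ)
            (-(η12 * (η22 + α11)⁻¹ * α12))
            (-(η12 * (η22 + α11)⁻¹ * α12))ᵀ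
            (α22 - α12ᵀ * (η22 + α11)⁻¹ * α12)) *ᵥ Sum.elim x y) +
      (1 / 2) * ((z + (η22 + α11)⁻¹ *ᵥ (η12ᵀ *ᵥ x + α12 *ᵥ y)) ⬝ᵥ
        (η22 + α11) *ᵥ (z + (η22 + α11)⁻¹ *ᵥ (η12ᵀ *ᵥ x + α12 *ᵥ y))) := by
    intro z
    have hz := hzS z
    simp only [Matrix.fromBlocks_mulVec, Sum.elim_comp_inl, Sum.elim_comp_inr,
      sumElim_dotProduct_sumElim, Matrix.transpose_neg, Matrix.transpose_mul, hTs]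
    generalize hS' : η22 + α11 = S at *
    generalize S⁻¹ = T at *
    have e1 : ∀ v, x ⬝ᵥ η12 *ᵥ v = (η12ᵀ *ᵥ x) ⬝ᵥ v := adj η12 x
    have e2 : ∀ v, y ⬝ᵥ α12ᵀ *ᵥ v = (α12 *ᵥ y) ⬝ᵥ v := fun v => by
      rw [adj, Matrix.transpose_transpose]
    have e3 : ∀ v, S *ᵥ (T *ᵥ v) = v := fun v => by
      rw [Matrix.mulVec_mulVec, hST, Matrix.one_mulVec]
    have e4 : ∀ u v, (T *ᵥ u) ⬝ᵥ S *ᵥ v = u ⬝ᵥ v := fun u v => by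
      rw [adj, hSs, e3]
    simp only [Matrix.sub_mulVec, Matrix.neg_mulVec, ← Matrix.mulVec_mulVec, dotProduct_add,
      dotProduct_sub, dotProduct_neg, Matrix.mulVec_add, add_dotProduct, e1, e2, e3, e4]
    generalize η12ᵀ *ᵥ x = p
    generalize α12 *ᵥ y = q
    have c1 := dotProduct_comm z p
    have c2 := dotProduct_comm z q
    have d1 := dotProduct_comm (T *ᵥ p) p
    have d2 := dotProduct_comm (T *ᵥ p) q
    have d3 := dotProduct_comm (T *ᵥ q) p
    have d4 := dotProduct_comm (T *ᵥ q) q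
    linarith
  constructor
  · refine ⟨-((η22 + α11)⁻¹ *ᵥ (η12ᵀ *ᵥ x + α12 *ᵥ y)), ?_⟩
    simp only [key]
    simp
  · rintro _ ⟨z, rfl⟩
    simp only [key]
    have h := hS.posSemidef.dotProduct_mulVec_nonneg
      (z + (η22 + α11)⁻¹ *ᵥ (η12ᵀ *ᵥ x + α12 *ᵥ y))
    rw [Matrix.neg_mulVec, dotProduct_neg, star_trivial] at h
    linarith
end

section
/- Semiconvex dual of a quadratic, inverse direction: Let n ≥ 1, let Q and q_a be symmetric real n×n matrices with −Q − q_a positive definite (i.e. q_a < −Q), let z̄ ∈ ℝⁿ and r_a ∈ ℝ, and define a(z) = (1/2)(z−z̄)ᵀ q_a (z−z̄) + r_a. Let U = Q + q_a (which is negative definite, hence invertible). Then the function φ(x) = sup_{z∈ℝⁿ} [ (1/2)(x−z)ᵀQ(x−z) + a(z) ] satisfies, for every x ∈ ℝⁿ, φ(x) = (1/2)(x−z̄)ᵀ [Q U⁻¹ q_a] (x−z̄) + r_a, and the supremum over z is attained. -/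
open Matrix

/-- Semiconvex dual of a quadratic, inverse direction: for symmetric `Q`, `q_a` with
`-Q - q_a` positive definite, `a z = (1/2)(z-z̄)ᵀ q_a (z-z̄) + r_a`, and `U = Q + q_a`,
the function `φ x = sup_z [(1/2)(x-z)ᵀ Q (x-z) + a z]` has the supremum attained and
equals `(1/2)(x-z̄)ᵀ (Q U⁻¹ q_a) (x-z̄) + r_a`. -/
theorem dual_quadratic_inverse (n : ℕ) (hn : 1 ≤ n)
    (Q qa : Matrix (Fin n) (Fin n) ℝ) (hQ : Q.IsSymm) (hqa : qa.IsSymm)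
    (hpd : (-Q - qa).PosDef) (zbar : Fin n → ℝ) (ra : ℝ) :
    ∀ x : Fin n → ℝ,
      IsGreatest
        (Set.range fun z : Fin n → ℝ =>
          (1 / 2) * ((x - z) ⬝ᵥ Q *ᵥ (x - z)) +
            ((1 / 2) * ((z - zbar) ⬝ᵥ qa *ᵥ (z - zbar)) + ra))
        ((1 / 2) * ((x - zbar) ⬝ᵥ (Q * (Q + qa)⁻¹ * qa) *ᵥ (x - zbar)) + ra) := by
  intro x
  have hU : IsUnit (Q + qa) := by
    have h := hpd.isUnit.neg
    have e : -(-Q - qa) = Q + qa := by abel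
    rwa [e] at h
  have hdet : IsUnit (Q + qa).det := (Matrix.isUnit_iff_isUnit_det _).mp hU
  obtain ⟨y, hy⟩ : ∃ y, y = x - zbar := ⟨_, rfl⟩
  obtain ⟨p, hp⟩ : ∃ p, p = (Q + qa)⁻¹ *ᵥ (Q *ᵥ y) := ⟨_, rfl⟩
  have hUp : Q *ᵥ p + qa *ᵥ p = Q *ᵥ y := by
    rw [← Matrix.add_mulVec, hp, Matrix.mulVec_mulVec, Matrix.mul_nonsing_inv _ hdet,
      Matrix.one_mulVec]
  have hs : (Q + qa)⁻¹ *ᵥ (qa *ᵥ y) = y - p := by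
    rw [hp, eq_sub_iff_add_eq, ← Matrix.mulVec_add, add_comm (qa *ᵥ y), ← Matrix.add_mulVec,
      Matrix.mulVec_mulVec, Matrix.nonsing_inv_mul _ hdet, Matrix.one_mulVec]
  have hv : (Q * (Q + qa)⁻¹ * qa) *ᵥ y = Q *ᵥ (y - p) := by
    rw [← hs, Matrix.mulVec_mulVec, Matrix.mulVec_mulVec, Matrix.mul_assoc]
  have symm : ∀ (M : Matrix (Fin n) (Fin n) ℝ), M.IsSymm → ∀ u v : Fin n → ℝ,
      u ⬝ᵥ M *ᵥ v = v ⬝ᵥ M *ᵥ u := by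
    intro M hM u v
    rw [Matrix.dotProduct_mulVec, ← Matrix.mulVec_transpose, hM.eq, dotProduct_comm]
  have key : ∀ d : Fin n → ℝ,
      (y - (p + d)) ⬝ᵥ Q *ᵥ (y - (p + d)) + (p + d) ⬝ᵥ qa *ᵥ (p + d)
        = y ⬝ᵥ Q *ᵥ (y - p) - d ⬝ᵥ (-Q - qa) *ᵥ d := by
    intro d
    have h1 := congrArg (fun v => p ⬝ᵥ v) hUp
    have h2 := congrArg (fun v => d ⬝ᵥ v) hUp
    simp only [dotProduct_add] at h1 h2
    simp only [Matrix.mulVec_add, Matrix.mulVec_sub, Matrix.sub_mulVec, Matrix.neg_mulVec,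
      dotProduct_add, dotProduct_sub, add_dotProduct, sub_dotProduct, dotProduct_neg]
    rw [symm Q hQ y p, symm Q hQ y d, symm Q hQ p d, symm qa hqa p d]
    linarith
  rw [← hy, hv]
  constructor
  · refine ⟨zbar + p, ?_⟩
    have h := key 0
    have e1 : x - (zbar + p) = y - (p + 0) := by rw [hy]; abel
    have e2 : zbar + p - zbar = p + 0 := by abel
    simp only [e1, e2]
    simp only [zero_dotProduct] at h
    linarith
  · rintro _ ⟨z, rfl⟩
    have h := key (z - zbar - p)
    have e1 : y - (p + (z - zbar - p)) = x - z := by rw [hy]; abel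
    have e2 : p + (z - zbar - p) = z - zbar := by abel
    rw [e1, e2] at h
    have h0 := hpd.posSemidef.dotProduct_mulVec_nonneg (z - zbar - p)
    rw [star_trivial] at h0
    dsimp only
    linarith
end

section
/- Semiconvex dual of a quadratic, forward direction: Let n ≥ 1, let Q and q_p be symmetric real n×n matrices with q_p − Q positive definite (i.e. q_p > Q), let x̄ ∈ ℝⁿ and r_p ∈ ℝ, and define φ(x) = (1/2)(x−x̄)ᵀ q_p (x−x̄) + r_p. Let Δ = Q − q_p (which is negative definite, hence invertible). Then the function a(z) = −sup_{x∈ℝⁿ} [ (1/2)(x−z)ᵀQ(x−z) − φ(x) ] satisfies, for every z ∈ ℝⁿ, a(z) = (1/2)(z−x̄)ᵀ [Q Δ⁻¹ q_p] (z−x̄) + r_p, and the supremum over x is attained. -/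
open Matrix

/-- Semiconvex dual of a quadratic, forward direction: for symmetric `Q`, `q_p` with
`q_p - Q` positive definite, `φ x = (1/2)(x-x̄)ᵀ q_p (x-x̄) + r_p`, and `Δ = Q - q_p`,
the function `a z = -sup_x [(1/2)(x-z)ᵀ Q (x-z) - φ x]` satisfies
`a z = (1/2)(z-x̄)ᵀ (Q Δ⁻¹ q_p) (z-x̄) + r_p`, the supremum over `x` being attained
(i.e. the supremum is attained and equals `-a z`). -/
theorem dual_quadratic_forward (n : ℕ) (hn : 1 ≤ n)
    (Q qp : Matrix (Fin n) (Fin n) ℝ) (hQ : Q.IsSymm) (hqp : qp.IsSymm)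
    (hpd : (qp - Q).PosDef) (xbar : Fin n → ℝ) (rp : ℝ) :
    ∀ z : Fin n → ℝ,
      IsGreatest
        (Set.range fun x : Fin n → ℝ =>
          (1 / 2) * ((x - z) ⬝ᵥ Q *ᵥ (x - z)) -
            ((1 / 2) * ((x - xbar) ⬝ᵥ qp *ᵥ (x - xbar)) + rp))
        (-((1 / 2) * ((z - xbar) ⬝ᵥ (Q * (Q - qp)⁻¹ * qp) *ᵥ (z - xbar)) + rp)) := by
  intro z
  have hsym : ∀ {A : Matrix (Fin n) (Fin n) ℝ}, A.IsSymm → ∀ a b : Fin n → ℝ,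
      a ⬝ᵥ A *ᵥ b = b ⬝ᵥ A *ᵥ a := by
    intro A hA a b
    rw [dotProduct_mulVec, dotProduct_comm, ← mulVec_transpose, hA.eq]
  obtain ⟨D, hD⟩ : ∃ D, D = Q - qp := ⟨_, rfl⟩
  have hq : qp = Q - D := by rw [hD]; abel
  have hDs : D.IsSymm := by rw [hD]; exact hQ.sub hqp
  have hneg : qp - Q = -D := by rw [hD]; abel
  rw [hneg] at hpd
  have hu : IsUnit D := by
    have := hpd.isUnit
    simpa using this
  have hdet : IsUnit D.det := (Matrix.isUnit_iff_isUnit_det D).1 hu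
  obtain ⟨w, hw⟩ : ∃ w, w = z - xbar := ⟨_, rfl⟩
  obtain ⟨s, hs⟩ : ∃ s, s = D⁻¹ *ᵥ (Q *ᵥ w) := ⟨_, rfl⟩
  have hDsv : D *ᵥ s = Q *ᵥ w := by
    rw [hs, mulVec_mulVec, Matrix.mul_nonsing_inv D hdet, one_mulVec]
  have hM : w ⬝ᵥ (Q * D⁻¹ * qp) *ᵥ w = w ⬝ᵥ Q *ᵥ s - w ⬝ᵥ Q *ᵥ w := by
    have : Q * D⁻¹ * qp = Q * D⁻¹ * Q - Q := by
      rw [hq, Matrix.mul_sub, Matrix.mul_assoc Q D⁻¹ D, Matrix.nonsing_inv_mul D hdet,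
        Matrix.mul_one]
    rw [this, sub_mulVec, dotProduct_sub, hs, mulVec_mulVec, mulVec_mulVec, Matrix.mul_assoc]
  have key : ∀ x : Fin n → ℝ, (1 / 2) * ((x - z) ⬝ᵥ Q *ᵥ (x - z)) -
            ((1 / 2) * ((x - xbar) ⬝ᵥ qp *ᵥ (x - xbar)) + rp) =
      (1 / 2) * ((x - xbar - s) ⬝ᵥ D *ᵥ (x - xbar - s)) +
      (-((1 / 2) * (w ⬝ᵥ (Q * D⁻¹ * qp) *ᵥ w) + rp)) := by
    intro x
    obtain ⟨u, hu⟩ : ∃ u, u = x - xbar := ⟨_, rfl⟩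
    have hxz : x - z = u - w := by rw [hu, hw]; abel
    rw [hM, hxz, ← hu, hq]
    simp only [sub_mulVec, mulVec_sub, dotProduct_sub, sub_dotProduct]
    rw [hsym hDs s u, hDsv, hsym hQ w u, hsym hQ w s]
    ring
  rw [← hD, ← hw]
  constructor
  · refine ⟨xbar + s, ?_⟩
    change (1 / 2) * ((xbar + s - z) ⬝ᵥ Q *ᵥ (xbar + s - z)) - _ = _
    rw [key]
    simp
  · rintro _ ⟨x, rfl⟩
    change (1 / 2) * ((x - z) ⬝ᵥ Q *ᵥ (x - z)) - _ ≤ _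
    rw [key]
    have h := hpd.posSemidef.dotProduct_mulVec_nonneg (x - xbar - s)
    rw [star_trivial, neg_mulVec, dotProduct_neg] at h
    linarith
end

section
/- Max-linear combinations via the preorders ≤_j: Let n ≥ 1, m ≥ 1, and let y, x¹, …, xᵐ ∈ ℝ≥0ⁿ. The following are equivalent: (1) y is a max-linear combination of x¹, …, xᵐ, i.e. there exist λ₁, …, λ_m ∈ ℝ≥0 with y_j = max_{1≤i≤m} λ_i · xⁱ_j for every coordinate j; (2) for every j with y_j ≠ 0 there exists l ∈ {1,…,m} with xˡ ≤_j y. -/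
open scoped NNReal

/-- The preorder `≤_j` on `ℝ≥0ⁿ`: `u ≤_j v` iff `u_j ≠ 0`, `v_j ≠ 0`, and
`u_k / u_j ≤ v_k / v_j` for every coordinate `k`. -/
def leJ {n : ℕ} (j : Fin n) (u v : Fin n → ℝ≥0) : Prop :=
  u j ≠ 0 ∧ v j ≠ 0 ∧ ∀ k, u k / u j ≤ v k / v j

/-- Max-linear combinations via the preorders `≤_j`: `y` is a max-linear combination
of `x¹, …, xᵐ` iff for every `j` in the support of `y` some `xˡ` satisfies
`xˡ ≤_j y`. -/
theorem maxlinear_combination_iff_leJ (n m : ℕ) (hn : 1 ≤ n) (hm : 1 ≤ m)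
    (y : Fin n → ℝ≥0) (x : Fin m → Fin n → ℝ≥0) :
    (∃ lam : Fin m → ℝ≥0, ∀ j, y j = Finset.univ.sup fun i => lam i * x i j) ↔
    (∀ j, y j ≠ 0 → ∃ l, leJ j (x l) y) := by
  classical
  constructor
  · rintro ⟨lam, h⟩ j hj
    have hne : (Finset.univ : Finset (Fin m)).Nonempty := ⟨⟨0, hm⟩, Finset.mem_univ _⟩
    obtain ⟨l, -, hl⟩ := Finset.exists_mem_eq_sup Finset.univ hne (fun i => lam i * x i j)
    have hyl : y j = lam l * x l j := (h j).trans hl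
    have hx : x l j ≠ 0 := by
      intro h0
      exact hj (by rw [hyl, h0, mul_zero])
    have hlam : lam l ≠ 0 := by
      intro h0
      exact hj (by rw [hyl, h0, zero_mul])
    refine ⟨l, hx, hj, fun k => ?_⟩
    have hk : lam l * x l k ≤ y k := by
      rw [h k]
      exact Finset.le_sup (f := fun i => lam i * x i k) (Finset.mem_univ l)
    calc x l k / x l j = (lam l * x l k) / (lam l * x l j) := (mul_div_mul_left _ _ hlam).symm
      _ ≤ y k / (lam l * x l j) := by gcongr
      _ = y k / y j := by rw [hyl]
  · intro h
    refine ⟨fun i => Finset.univ.sup fun j => if leJ j (x i) y then y j / x i j else 0,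
      fun k => le_antisymm ?_ ?_⟩
    · by_cases hk : y k = 0
      · rw [hk]
        exact zero_le
      · obtain ⟨l, hl⟩ := h k hk
        refine le_trans ?_ (Finset.le_sup (Finset.mem_univ l))
        have h1 : y k / x l k ≤
            Finset.univ.sup fun j => if leJ j (x l) y then y j / x l j else 0 := by
          refine le_trans ?_ (Finset.le_sup (Finset.mem_univ k))
          simp [hl]
        calc y k = y k / x l k * x l k := (div_mul_cancel₀ _ hl.1).symm
          _ ≤ _ := mul_le_mul_left h1 _
    · refine Finset.sup_le fun i _ => ?_
      by_cases hx : x i k = 0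
      · simp [hx]
      · rw [← le_div_iff₀ (pos_iff_ne_zero.mpr hx)]
        refine Finset.sup_le fun j _ => ?_
        split_ifs with hj
        · obtain ⟨h1, h2, h3⟩ := hj
          have h4 := h3 k
          rw [div_le_div_iff₀ (pos_iff_ne_zero.mpr h1) (pos_iff_ne_zero.mpr h2)] at h4
          rw [div_le_div_iff₀ (pos_iff_ne_zero.mpr h1) (pos_iff_ne_zero.mpr hx)]
          rwa [mul_comm (y j)]
        · exact zero_le
end

section
/- Extremals are minimal elements: Let n ≥ 1, let S ⊆ ℝ≥0ⁿ, let K be the subsemimodule of ℝ≥0ⁿ generated by S, and let y ∈ K with y ≠ 0. The following are equivalent: (1) y is an extremal of K, i.e. whenever y = x ⊕ z with x, z ∈ K then y = x or y = z; (2) there exists a coordinate j with y_j ≠ 0 such that y is minimal in K with respect to the preorder ≤_j, i.e. every v ∈ K with v ≤_j y satisfies y ≤_j v. -/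
open scoped NNReal

/-- The subsemimodule of `ℝ≥0ⁿ` (over the max-times semiring) generated by a set `S`:
`0` together with all max-linear combinations `λ₁ ⊙ u¹ ⊕ ⋯ ⊕ λ_m ⊙ uᵐ`, `m ≥ 1`,
of elements of `S`. -/
def maxSpan {n : ℕ} (S : Set (Fin n → ℝ≥0)) : Set (Fin n → ℝ≥0) :=
  insert 0 { v | ∃ (m : ℕ) (u : Fin (m + 1) → Fin n → ℝ≥0) (lam : Fin (m + 1) → ℝ≥0),
    (∀ i, u i ∈ S) ∧ v = fun j => Finset.univ.sup fun i => lam i * u i j }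

theorem maxSpan_smul {n : ℕ} {S : Set (Fin n → ℝ≥0)} (c : ℝ≥0) {v : Fin n → ℝ≥0}
    (hv : v ∈ maxSpan S) : (fun k => c * v k) ∈ maxSpan S := by
  rcases hv with rfl | ⟨m, u, lam, hu, rfl⟩
  · left; funext k; simp
  · right
    refine ⟨m, u, fun i => c * lam i, hu, ?_⟩
    funext k
    simp only [NNReal.mul_finset_sup, mul_assoc]

theorem maxSpan_sup {n : ℕ} {S : Set (Fin n → ℝ≥0)} {v w : Fin n → ℝ≥0}
    (hv : v ∈ maxSpan S) (hw : w ∈ maxSpan S) : v ⊔ w ∈ maxSpan S := by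
  have h0 : ∀ x : Fin n → ℝ≥0, 0 ≤ x := fun x k => zero_le
  rcases hv with rfl | ⟨m, u, lam, hu, rfl⟩
  · rwa [sup_eq_right.2 (h0 w)]
  rcases hw with rfl | ⟨m', u', lam', hu', rfl⟩
  · rw [sup_eq_left.2 (h0 _)]
    exact Or.inr ⟨m, u, lam, hu, rfl⟩
  right
  refine ⟨(m + 1) + m', Fin.append (n := m' + 1) u u',
    Fin.append (n := m' + 1) lam lam', ?_, ?_⟩
  · intro i
    refine Fin.addCases (m := m + 1) (n := m' + 1) (fun i => ?_) (fun i => ?_) i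
    · rw [Fin.append_left]; exact hu i
    · rw [Fin.append_right]; exact hu' i
  · funext k
    apply le_antisymm
    · refine sup_le (Finset.sup_le fun i _ => ?_) (Finset.sup_le fun i _ => ?_)
      · refine le_trans (le_of_eq ?_) (Finset.le_sup (Finset.mem_univ
          (Fin.castAdd (m' + 1) i : Fin (m + 1 + (m' + 1)))))
        simp only [Fin.append_left]
      · refine le_trans (le_of_eq ?_) (Finset.le_sup (Finset.mem_univ
          (Fin.natAdd (m + 1) i : Fin (m + 1 + (m' + 1)))))
        simp only [Fin.append_right]
    · refine Finset.sup_le fun i _ => ?_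
      refine Fin.addCases (m := m + 1) (n := m' + 1) (fun i => ?_) (fun i => ?_) i
      · rw [Fin.append_left, Fin.append_left]
        exact le_trans (Finset.le_sup (f := fun i => lam i * u i k) (Finset.mem_univ i))
          le_sup_left
      · rw [Fin.append_right, Fin.append_right]
        exact le_trans (Finset.le_sup (f := fun i => lam' i * u' i k) (Finset.mem_univ i))
          le_sup_right

theorem eq_of_minimal {n : ℕ} {y x : Fin n → ℝ≥0} {j : Fin n} (hj : y j ≠ 0)
    (hxy : x ≤ y) (hx : x j = y j) (h : leJ j x y → leJ j y x) : y = x := by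
  have h1 := (h ⟨hx ▸ hj, hj, fun k => by rw [hx]; exact div_le_div_of_nonneg_right (hxy k) zero_le⟩).2.2
  refine le_antisymm (fun k => ?_) hxy
  have := h1 k
  rw [hx] at this
  exact (div_le_div_iff_of_pos_right (pos_iff_ne_zero.2 hj)).1 this

/-- Extremals are minimal elements: for `y ≠ 0` in the subsemimodule `K` generated by
`S`, `y` is an extremal of `K` (i.e. `y = x ⊔ z` with `x, z ∈ K` forces `y = x` or
`y = z`) iff for some coordinate `j` with `y_j ≠ 0`, `y` is a minimal element of `K`
with respect to `≤_j`. -/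
theorem extremal_iff_minimal (n : ℕ) (hn : 1 ≤ n) (S : Set (Fin n → ℝ≥0))
    (y : Fin n → ℝ≥0) (hy : y ∈ maxSpan S) (hy0 : y ≠ 0) :
    (∀ x ∈ maxSpan S, ∀ z ∈ maxSpan S, y = x ⊔ z → y = x ∨ y = z) ↔
    (∃ j, y j ≠ 0 ∧ ∀ v ∈ maxSpan S, leJ j v y → leJ j y v) := by
  constructor
  · intro hext
    by_contra hcon
    push Not at hcon
    have key : ∀ j, ∃ w ∈ maxSpan S, w ≤ y ∧ w j = y j ∧ y ≠ w := by
      intro j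
      by_cases hj : y j = 0
      · exact ⟨0, Or.inl rfl, fun k => zero_le, hj.symm, hy0⟩
      · obtain ⟨v, hv, ⟨hvj, _, hle⟩, hn⟩ := hcon j hj
        refine ⟨_, maxSpan_smul (y j / v j) hv, fun k => ?_, ?_, ?_⟩
        · have h := mul_le_mul_right (hle k) (y j)
          calc y j / v j * v k = y j * (v k / v j) := by ring
            _ ≤ y j * (y k / y j) := h
            _ = y k := by field_simp
        · exact div_mul_cancel₀ _ hvj
        · intro he
          refine hn ⟨hj, hvj, fun k => le_of_eq ?_⟩
          have h := congrFun he k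
          rw [h]
          field_simp
    choose w hwK hwy hwj hne using key
    have ind : ∀ T : Finset (Fin n), T.sup w ∈ maxSpan S ∧ y ≠ T.sup w := by
      intro T
      induction T using Finset.induction_on with
      | empty => exact ⟨Or.inl rfl, hy0⟩
      | insert a T _ ih =>
        rw [Finset.sup_insert]
        refine ⟨maxSpan_sup (hwK a) ih.1, fun he => ?_⟩
        rcases hext _ (hwK a) _ ih.1 he with h | h
        · exact hne a h
        · exact ih.2 h
    refine (ind Finset.univ).2 (le_antisymm (fun k => ?_) (Finset.sup_le fun i _ => hwy i))
    rw [← hwj k]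
    exact Finset.le_sup (f := w) (Finset.mem_univ k) k
  · rintro ⟨j, hj, hmin⟩ x hx z hz he
    have hxy : x ≤ y := he ▸ le_sup_left
    have hzy : z ≤ y := he ▸ le_sup_right
    have hej : y j = x j ⊔ z j := congrFun he j
    rcases le_total (x j) (z j) with h | h
    · right
      exact eq_of_minimal hj hzy (by rw [hej, sup_eq_right.2 h]) (hmin z hz)
    · left
      exact eq_of_minimal hj hxy (by rw [hej, sup_eq_left.2 h]) (hmin x hx)
end

section
/- Essential uniqueness of generating sets: Let n ≥ 1 and let S ⊆ ℝ≥0ⁿ be a set of vectors each normalized so that max_k u_k = 1 for all u ∈ S. Let K be the subsemimodule of ℝ≥0ⁿ generated by S, and let E be the set of extremals u of K with max_k u_k = 1. Then E ⊆ S, and the set F = S ∖ E is redundant: for every u ∈ F, the subsemimodule generated by S ∖ {u} equals K. -/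
open scoped NNReal

/-- `u` is an extremal of the subsemimodule `K`: `u ∈ K`, `u ≠ 0`, and whenever
`u = x ⊔ z` with `x, z ∈ K` then `u = x` or `u = z`. -/
def IsExtremal {n : ℕ} (K : Set (Fin n → ℝ≥0)) (u : Fin n → ℝ≥0) : Prop :=
  u ∈ K ∧ u ≠ 0 ∧ ∀ x ∈ K, ∀ z ∈ K, u = x ⊔ z → u = x ∨ u = z

theorem maxSpan_ind {n : ℕ} {S : Set (Fin n → ℝ≥0)} (P : (Fin n → ℝ≥0) → Prop)
    (h0 : P 0) (h1 : ∀ (c : ℝ≥0), ∀ u ∈ S, P (c • u)) (h2 : ∀ x z, P x → P z → P (x ⊔ z))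
    {v : Fin n → ℝ≥0} (hv : v ∈ maxSpan S) : P v := by
  rcases hv with rfl | ⟨m, u, lam, hu, rfl⟩
  · exact h0
  · have : (fun j => Finset.univ.sup fun i => lam i * u i j)
        = Finset.univ.sup (fun i => lam i • u i) := by
      ext j
      rw [Finset.sup_apply]
      rfl
    rw [this]
    exact Finset.sup_induction h0 (fun a ha b hb => h2 a b ha hb) (fun i _ => h1 _ _ (hu i))

theorem maxSpan_smul_s8 {n : ℕ} {S : Set (Fin n → ℝ≥0)} (c : ℝ≥0) {u : Fin n → ℝ≥0}
    (hu : u ∈ S) : c • u ∈ maxSpan S := by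
  refine Or.inr ⟨0, fun _ => u, fun _ => c, fun _ => hu, ?_⟩
  ext j
  simp

theorem maxSpan_sup_s8 {n : ℕ} {S : Set (Fin n → ℝ≥0)} {x z : Fin n → ℝ≥0}
    (hx : x ∈ maxSpan S) (hz : z ∈ maxSpan S) : x ⊔ z ∈ maxSpan S := by
  rcases hx with rfl | ⟨m, u, lam, hu, rfl⟩
  · rwa [show (0 : Fin n → ℝ≥0) ⊔ z = z from sup_eq_right.2 (zero_le)]
  rcases hz with rfl | ⟨m', u', lam', hu', rfl⟩
  · rw [sup_eq_left.2 (zero_le)]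
    exact Or.inr ⟨m, u, lam, hu, rfl⟩
  refine Or.inr ⟨m + 1 + m', Fin.append (n := m' + 1) u u',
    Fin.append (n := m' + 1) lam lam', ?_, ?_⟩
  · intro i
    refine Fin.addCases (m := m + 1) (n := m' + 1) (fun i => ?_) (fun i => ?_) i
    · rw [Fin.append_left]; exact hu i
    · rw [Fin.append_right]; exact hu' i
  · ext j
    congr 1
    apply le_antisymm
    · refine sup_le (Finset.sup_le fun i _ => ?_) (Finset.sup_le fun i _ => ?_)
      · refine le_trans (le_of_eq ?_) (Finset.le_sup (Finset.mem_univ (Fin.castAdd (m' + 1) i)))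
        simp only [Fin.append_left]
      · refine le_trans (le_of_eq ?_) (Finset.le_sup (Finset.mem_univ (Fin.natAdd (m + 1) i)))
        simp only [Fin.append_right]
    · refine Finset.sup_le fun i _ => ?_
      refine Fin.addCases (m := m + 1) (n := m' + 1) (fun i => ?_) (fun i => ?_) i
      · rw [Fin.append_left, Fin.append_left]
        exact le_sup_of_le_left
          (Finset.le_sup (f := fun i => lam i * u i j) (Finset.mem_univ i))
      · rw [Fin.append_right, Fin.append_right]
        exact le_sup_of_le_right
          (Finset.le_sup (f := fun i => lam' i * u' i j) (Finset.mem_univ i))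

theorem smul_sup_smul {n : ℕ} (a b : ℝ≥0) (u : Fin n → ℝ≥0) :
    a • u ⊔ b • u = (a ⊔ b) • u := by
  ext j
  simp only [Pi.sup_apply, Pi.smul_apply, smul_eq_mul]
  rw [max_mul_of_nonneg _ _ (zero_le)]

theorem maxSpan_decomp {n : ℕ} {S : Set (Fin n → ℝ≥0)} (u : Fin n → ℝ≥0)
    {x : Fin n → ℝ≥0} (hx : x ∈ maxSpan S) :
    ∃ a : ℝ≥0, ∃ w ∈ maxSpan (S \ {u}), x = a • u ⊔ w := by
  refine maxSpan_ind (fun x => ∃ a : ℝ≥0, ∃ w ∈ maxSpan (S \ {u}), x = a • u ⊔ w) ?_ ?_ ?_ hx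
  · exact ⟨0, 0, Or.inl rfl, by simp⟩
  · intro c v hv
    by_cases h : v = u
    · subst h
      exact ⟨c, 0, Or.inl rfl, (sup_eq_left.2 (zero_le)).symm⟩
    · refine ⟨0, c • v, maxSpan_smul_s8 c ⟨hv, h⟩, ?_⟩
      rw [zero_smul]
      exact (sup_eq_right.2 (zero_le)).symm
  · rintro x z ⟨a, w, hw, rfl⟩ ⟨b, w', hw', rfl⟩
    exact ⟨a ⊔ b, w ⊔ w', maxSpan_sup_s8 hw hw', by rw [sup_sup_sup_comm, smul_sup_smul]⟩

theorem coef_lt_one {n : ℕ} {a : ℝ≥0} {u x w : Fin n → ℝ≥0} (hx : x = a • u ⊔ w)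
    (hle : x ≤ u) (hne : u ≠ x) : a < 1 := by
  by_contra h
  push Not at h
  apply hne
  refine le_antisymm ?_ hle
  rw [hx]
  refine le_sup_of_le_left fun j => ?_
  exact le_mul_of_one_le_left (zero_le) h

/-- Essential uniqueness of generating sets: if every `u ∈ S` is normalized so that
`max_k u_k = 1`, and `E` is the set of extremals of `K = maxSpan S` with
`max_k u_k = 1`, then `E ⊆ S` and `F = S \ E` is redundant: removing any single
element of `F` from `S` does not change the generated subsemimodule. -/
theorem generating_set_essential_uniqueness (n : ℕ) (hn : 1 ≤ n)
    (S : Set (Fin n → ℝ≥0)) (hS : ∀ u ∈ S, Finset.univ.sup u = 1) :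
    ({u | IsExtremal (maxSpan S) u ∧ Finset.univ.sup u = 1} ⊆ S) ∧
    (∀ u ∈ S \ {u | IsExtremal (maxSpan S) u ∧ Finset.univ.sup u = 1},
      maxSpan (S \ {u}) = maxSpan S) := by
  constructor
  · rintro e ⟨⟨heK, he0, hex⟩, hn1⟩
    have key := maxSpan_ind (S := S)
      (fun v => v ∈ maxSpan S ∧ (v = e → ∃ c : ℝ≥0, ∃ u ∈ S, e = c • u))
      ⟨Or.inl rfl, fun h => absurd h.symm he0⟩
      (fun c u hu => ⟨maxSpan_smul_s8 c hu, fun h => ⟨c, u, hu, h.symm⟩⟩)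
      (fun x z hx hz => ⟨maxSpan_sup_s8 hx.1 hz.1, fun h => by
        rcases hex x hx.1 z hz.1 h.symm with h | h
        · exact hx.2 h.symm
        · exact hz.2 h.symm⟩) heK
    obtain ⟨c, u, hu, rfl⟩ := key.2 rfl
    have hc : Finset.univ.sup (c • u) = c * Finset.univ.sup u := by
      rw [NNReal.mul_finset_sup]
      rfl
    rw [hn1, hS u hu, mul_one] at hc
    rw [← hc, one_smul]
    exact hu
  · rintro u ⟨huS, hu⟩
    have huK : u ∈ maxSpan S := by simpa using maxSpan_smul_s8 1 huS
    have hu0 : u ≠ 0 := by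
      rintro rfl
      have := hS 0 huS
      have h2 : Finset.univ.sup (0 : Fin n → ℝ≥0) = 0 :=
        le_antisymm (Finset.sup_le fun _ _ => le_rfl) (zero_le)
      rw [h2] at this
      exact zero_ne_one this
    have hne : ¬ IsExtremal (maxSpan S) u := fun h => hu ⟨h, hS u huS⟩
    unfold IsExtremal at hne
    push Not at hne
    obtain ⟨x, hx, z, hz, hxz, hux, huz⟩ := hne huK hu0
    obtain ⟨a, w, hw, hxa⟩ := maxSpan_decomp u hx
    obtain ⟨b, w', hw', hzb⟩ := maxSpan_decomp u hz
    have ha : a < 1 := coef_lt_one hxa (hxz ▸ le_sup_left) hux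
    have hb : b < 1 := coef_lt_one hzb (hxz ▸ le_sup_right) huz
    have hc : a ⊔ b < 1 := max_lt ha hb
    have huw : u = (a ⊔ b) • u ⊔ (w ⊔ w') := by
      rw [← smul_sup_smul, sup_sup_sup_comm, ← hxa, ← hzb]
      exact hxz
    have hmem : u ∈ maxSpan (S \ {u}) := by
      have : u = w ⊔ w' := by
        ext j
        congr 1
        have hj := congrFun huw j
        rw [Pi.sup_apply, Pi.smul_apply, smul_eq_mul] at hj
        rcases eq_or_ne (u j) 0 with h | h
        · rw [h, mul_zero] at hj
          rw [h, hj]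
          exact sup_eq_right.2 (zero_le)
        · have hlt : (a ⊔ b) * u j < u j := mul_lt_of_lt_one_left (pos_iff_ne_zero.2 h) hc
          rcases max_choice ((a ⊔ b) * u j) ((w ⊔ w') j) with h' | h'
          · exact absurd (hj.trans h') hlt.ne'
          · exact hj.trans h'
      have h2 := maxSpan_sup_s8 hw hw'
      rwa [← this] at h2
    have hsm : ∀ c : ℝ≥0, ∀ v ∈ maxSpan (S \ {u}), c • v ∈ maxSpan (S \ {u}) := by
      intro c v hv
      refine maxSpan_ind (fun v => c • v ∈ maxSpan (S \ {u})) ?_ ?_ ?_ hv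
      · rw [smul_zero]; exact Or.inl rfl
      · intro d v hv
        rw [smul_smul]
        exact maxSpan_smul_s8 _ hv
      · intro x z hx hz
        have : c • (x ⊔ z) = c • x ⊔ c • z := by
          ext j
          simp only [Pi.sup_apply, Pi.smul_apply, smul_eq_mul]
          rw [mul_max_of_nonneg _ _ (zero_le)]
        rw [this]
        exact maxSpan_sup_s8 hx hz
    apply Set.Subset.antisymm
    · intro v hv
      exact maxSpan_ind (fun v => v ∈ maxSpan S) (Or.inl rfl)
        (fun c v hv => maxSpan_smul_s8 c hv.1) (fun _ _ => maxSpan_sup_s8) hv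
    · intro v hv
      obtain ⟨a, w, hw, rfl⟩ := maxSpan_decomp u hv
      exact maxSpan_sup_s8 (hsm a u hmem) hw
end

section
/- Tropical Minkowski theorem: Let n ≥ 1 and let K ⊆ ℝ≥0ⁿ be a subsemimodule (containing 0, closed under componentwise maximum and under scaling by nonnegative reals) that is closed in the Euclidean topology of ℝⁿ. Then K is generated by its extremals: every y ∈ K belongs to the subsemimodule of ℝ≥0ⁿ generated by the set of extremals of K; in particular every nonzero y ∈ K is a componentwise maximum of finitely many nonnegative scalar multiples of extremals of K. -/
open scoped NNReal

theorem exists_extremal_aux {n : ℕ} (K : Set (Fin n → ℝ≥0)) (hclosed : IsClosed K)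
    (y : Fin n → ℝ≥0) (hy : y ∈ K) (i : Fin n) (hi : y i ≠ 0) :
    ∃ u, IsExtremal K u ∧ u ≤ y ∧ u i = y i := by
  have hc : IsCompact (Set.Icc 0 y ∩ (K ∩ {x | x i = y i})) :=
    isCompact_Icc.inter_right
      (hclosed.inter (isClosed_eq (continuous_apply i) continuous_const))
  have hcont : ContinuousOn (fun x : Fin n → ℝ≥0 => ∑ j, x j)
      (Set.Icc 0 y ∩ (K ∩ {x | x i = y i})) := by fun_prop
  obtain ⟨u, ⟨⟨-, huy⟩, huK, hui⟩, hmin⟩ :=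
    hc.exists_isMinOn ⟨y, ⟨zero_le, le_refl y⟩, hy, rfl⟩ hcont
  have hui : u i = y i := hui
  have key : ∀ x ∈ K, x ≤ u → x i = y i → u = x := by
    intro x hx hxu hxi
    have h1 : ∑ j, u j ≤ ∑ j, x j := hmin ⟨⟨zero_le, hxu.trans huy⟩, hx, hxi⟩
    have h2 : ∑ j, x j = ∑ j, u j := le_antisymm (Finset.sum_le_sum fun j _ => hxu j) h1
    have h3 := (Finset.sum_eq_sum_iff_of_le (fun j _ => hxu j)).1 h2
    funext j
    exact (h3 j (Finset.mem_univ j)).symm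
  refine ⟨u, ⟨huK, ?_, ?_⟩, huy, hui⟩
  · rintro rfl
    exact hi hui.symm
  · intro x hx z hz h
    have hxu : x ≤ u := h ▸ le_sup_left
    have hzu : z ≤ u := h ▸ le_sup_right
    have h4 : u i = x i ⊔ z i := congrFun h i
    rcases le_total (x i) (z i) with h5 | h5
    · right
      exact key z hz hzu (by rw [← hui, h4, sup_eq_right.2 h5])
    · left
      exact key x hx hxu (by rw [← hui, h4, sup_eq_left.2 h5])

/-- Tropical Minkowski theorem: a topologically closed subsemimodule `K` of `ℝ≥0ⁿ`
(containing `0`, closed under componentwise maximum and under scaling) is generated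
by its extremals. -/
theorem tropical_minkowski (n : ℕ) (hn : 1 ≤ n) (K : Set (Fin n → ℝ≥0))
    (h0 : (0 : Fin n → ℝ≥0) ∈ K)
    (hsup : ∀ x ∈ K, ∀ z ∈ K, x ⊔ z ∈ K)
    (hsmul : ∀ c : ℝ≥0, ∀ x ∈ K, (fun j => c * x j) ∈ K)
    (hclosed : IsClosed K) :
    ∀ y ∈ K, y ∈ maxSpan {u | IsExtremal K u} := by
  intro y hy
  by_cases hy0 : y = 0
  · exact Or.inl hy0
  right
  obtain ⟨i0, hi0⟩ : ∃ i, y i ≠ 0 := by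
    by_contra! h
    exact hy0 (funext h)
  have hex : ∀ i, ∃ u, IsExtremal K u ∧ u ≤ y ∧ u i = y i := by
    intro i
    by_cases hi : y i = 0
    · obtain ⟨u, hu, huy, -⟩ := exists_extremal_aux K hclosed y hy i0 hi0
      exact ⟨u, hu, huy, le_antisymm (huy i) (hi ▸ zero_le)⟩
    · exact exists_extremal_aux K hclosed y hy i hi
  choose u hu huy hui using hex
  obtain ⟨m, rfl⟩ : ∃ m, n = m + 1 := ⟨n - 1, by omega⟩
  refine ⟨m, u, fun _ => 1, hu, ?_⟩
  funext j
  simp only [one_mul]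
  apply le_antisymm
  · rw [← hui j]
    exact Finset.le_sup (f := fun i => u i j) (Finset.mem_univ j)
  · exact Finset.sup_le fun i _ => huy i j
end

section
/- Kleene stars and column spans: Let n ≥ 1 and let A and B be n×n matrices with entries in ℝ≥0 such that every cycle product of A and of B is at most 1 (i.e. λ(A) ≤ 1 and λ(B) ≤ 1). Then A* = B* if and only if the column spans of A* and B* coincide, i.e. {A* ⊙ x : x ∈ ℝ≥0ⁿ} = {B* ⊙ x : x ∈ ℝ≥0ⁿ}. -/
open scoped NNReal

/-- Max-times product of matrices over `ℝ≥0`: `(M ⊙ N)_{ij} = max_k M_{ik}·N_{kj}`. -/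
def mProd {n : ℕ} (A B : Matrix (Fin n) (Fin n) ℝ≥0) : Matrix (Fin n) (Fin n) ℝ≥0 :=
  fun i j => Finset.univ.sup fun k => A i k * B k j

/-- Max-times identity matrix. -/
def mId {n : ℕ} : Matrix (Fin n) (Fin n) ℝ≥0 := fun i j => if i = j then 1 else 0

/-- Max-times matrix powers. -/
def mPow {n : ℕ} (A : Matrix (Fin n) (Fin n) ℝ≥0) : ℕ → Matrix (Fin n) (Fin n) ℝ≥0
  | 0 => mId
  | k + 1 => mProd A (mPow A k)

/-- Kleene star `A* = I ⊕ A ⊕ A² ⊕ ⋯`, entrywise `(A*)_{ij} = sup_{k≥0} (A^k)_{ij}`. -/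
noncomputable def mStar {n : ℕ} (A : Matrix (Fin n) (Fin n) ℝ≥0) :
    Matrix (Fin n) (Fin n) ℝ≥0 :=
  fun i j => ⨆ k : ℕ, mPow A k i j

/-- Every cycle product of `A` is at most `1` (i.e. `λ(A) ≤ 1`): for every cyclic
sequence of indices `i₁, …, i_k` (`k ≥ 1`), `A_{i₁i₂}·A_{i₂i₃}⋯A_{i_k i₁} ≤ 1`. -/
def CycleProdsLeOne {n : ℕ} (A : Matrix (Fin n) (Fin n) ℝ≥0) : Prop :=
  ∀ (k : ℕ) (p : Fin (k + 1) → Fin n), (∏ l : Fin (k + 1), A (p l) (p (l + 1))) ≤ 1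

/-- Max-times matrix-vector product: `(M ⊙ x)_i = max_j M_{ij}·x_j`. -/
def mMulVec {n : ℕ} (M : Matrix (Fin n) (Fin n) ℝ≥0) (x : Fin n → ℝ≥0) : Fin n → ℝ≥0 :=
  fun i => Finset.univ.sup fun j => M i j * x j

theorem mPow_mul_le {n : ℕ} (A : Matrix (Fin n) (Fin n) ℝ≥0) (a b : ℕ) (i l j : Fin n) :
    mPow A a i l * mPow A b l j ≤ mPow A (a + b) i j := by
  induction a generalizing i with
  | zero =>
    by_cases h : i = l
    · subst h; simp [mPow, mId]
    · simp [mPow, mId, h]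
  | succ a ih =>
    rw [show a + 1 + b = (a + b) + 1 by omega]
    simp only [mPow, mProd]
    rw [NNReal.finset_sup_mul]
    apply Finset.sup_le
    intro k _
    calc A i k * mPow A a k l * mPow A b l j = A i k * (mPow A a k l * mPow A b l j) := by ring
      _ ≤ A i k * mPow A (a + b) k j := by gcongr; exact ih k
      _ ≤ _ := Finset.le_sup (f := fun k => A i k * mPow A (a + b) k j) (Finset.mem_univ k)

theorem walk_le {n : ℕ} (A : Matrix (Fin n) (Fin n) ℝ≥0) (k : ℕ) (p : ℕ → Fin n) :
    ∏ l ∈ Finset.range k, A (p l) (p (l + 1)) ≤ mPow A k (p 0) (p k) := by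
  induction k generalizing p with
  | zero => simp [mPow, mId]
  | succ k ih =>
    rw [Finset.prod_range_succ', mul_comm]
    simp only [mPow, mProd]
    calc _ ≤ A (p 0) (p 1) * mPow A k (p 1) (p (k + 1)) := by
          gcongr
          · exact ih (fun t => p (t + 1))
      _ ≤ _ := Finset.le_sup (f := fun l => A (p 0) l * mPow A k l (p (k + 1))) (Finset.mem_univ _)

theorem exists_walk {n : ℕ} (A : Matrix (Fin n) (Fin n) ℝ≥0) (k : ℕ) (i j : Fin n) :
    mPow A k i j = 0 ∨ ∃ p : ℕ → Fin n, p 0 = i ∧ p k = j ∧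
      mPow A k i j = ∏ l ∈ Finset.range k, A (p l) (p (l + 1)) := by
  induction k generalizing i with
  | zero =>
    by_cases h : i = j
    · right; exact ⟨fun _ => i, rfl, h, by simp [mPow, mId, h]⟩
    · left; simp [mPow, mId, h]
  | succ k ih =>
    obtain ⟨l, _, hl⟩ := Finset.exists_mem_eq_sup (Finset.univ : Finset (Fin n)) ⟨i, Finset.mem_univ i⟩
      (fun l => A i l * mPow A k l j)
    have hl' : mPow A (k + 1) i j = A i l * mPow A k l j := hl
    rcases ih l with h | ⟨p, h0, hk, hp⟩
    · left; rw [hl', h, mul_zero]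
    · right
      refine ⟨fun t => Nat.casesOn t i p, rfl, hk, ?_⟩
      rw [hl', hp, Finset.prod_range_succ', mul_comm]
      simp [h0]

theorem cycle_le {n : ℕ} {A : Matrix (Fin n) (Fin n) ℝ≥0} (hA : CycleProdsLeOne A)
    (t : ℕ) (p : ℕ → Fin n) (hp : p (t + 1) = p 0) :
    ∏ l ∈ Finset.range (t + 1), A (p l) (p (l + 1)) ≤ 1 := by
  refine le_trans (le_of_eq ?_) (hA t (fun l => p l))
  rw [Fin.prod_univ_castSucc, Finset.prod_range_succ, ← Fin.prod_univ_eq_prod_range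
    (fun l => A (p l) (p (l + 1)))]
  simp [hp]

theorem mPow_bdd {n : ℕ} {A : Matrix (Fin n) (Fin n) ℝ≥0} (hA : CycleProdsLeOne A) :
    ∃ C : ℝ≥0, ∀ k i j, mPow A k i j ≤ C := by
  refine ⟨(Finset.range n).sup fun m => Finset.univ.sup fun i => Finset.univ.sup fun j =>
    mPow A m i j, ?_⟩
  intro k
  induction k using Nat.strong_induction_on with
  | _ k ih =>
  intro i j
  by_cases hk : k < n
  · refine le_trans ?_ (Finset.le_sup (Finset.mem_range.2 hk))
    refine le_trans ?_ (Finset.le_sup (Finset.mem_univ i))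
    exact Finset.le_sup (f := fun j => mPow A k i j) (Finset.mem_univ j)
  rcases exists_walk A k i j with h | ⟨p, h0, hpk, hp⟩
  · rw [h]; exact zero_le
  have key : ∃ a b, a < b ∧ b ≤ k ∧ p a = p b := by
    obtain ⟨x, y, hxy, h⟩ := Fintype.exists_ne_map_eq_of_card_lt
      (fun x : Fin (k + 1) => p x) (by simp; omega)
    rcases lt_or_gt_of_ne hxy with h' | h'
    · exact ⟨x, y, h', by omega, h⟩
    · exact ⟨y, x, h', by omega, h.symm⟩
  obtain ⟨a, b, hab, hbk, hpab⟩ := key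
  obtain ⟨t, rfl⟩ : ∃ t, b = a + (t + 1) := ⟨b - a - 1, by omega⟩
  obtain ⟨c, rfl⟩ : ∃ c, k = a + (t + 1) + c := ⟨k - (a + (t + 1)), by omega⟩
  refine le_trans ?_ (ih (a + c) (by omega) i j)
  rw [hp, Finset.prod_range_add, Finset.prod_range_add]
  have h1 := walk_le A a p
  have h2 := cycle_le hA t (fun l => p (a + l)) hpab.symm
  have h3 := walk_le A c (fun l => p (a + (t + 1) + l))
  have h4 := mPow_mul_le A a c i (p a) j
  simp only [add_zero] at h3
  rw [h0] at h1
  rw [← hpab, hpk] at h3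
  refine le_trans ?_ h4
  refine mul_le_mul' ?_ h3
  calc _ ≤ mPow A a i (p a) * 1 := mul_le_mul' h1 h2
    _ = _ := mul_one _

theorem mStar_le {n : ℕ} {A : Matrix (Fin n) (Fin n) ℝ≥0} (hA : CycleProdsLeOne A)
    (k : ℕ) (i j : Fin n) : mPow A k i j ≤ mStar A i j := by
  obtain ⟨C, hC⟩ := mPow_bdd hA
  exact le_ciSup (f := fun k => mPow A k i j) ⟨C, by rintro _ ⟨k, rfl⟩; exact hC k i j⟩ k

theorem mStar_mul {n : ℕ} {A : Matrix (Fin n) (Fin n) ℝ≥0} (hA : CycleProdsLeOne A)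
    (i l j : Fin n) : mStar A i l * mStar A l j ≤ mStar A i j := by
  conv_lhs => simp only [mStar]
  rw [NNReal.iSup_mul]
  refine ciSup_le fun a => ?_
  rw [NNReal.mul_iSup]
  refine ciSup_le fun b => ?_
  exact (mPow_mul_le A a b i l j).trans (mStar_le hA _ i j)

theorem one_le_mStar {n : ℕ} {A : Matrix (Fin n) (Fin n) ℝ≥0} (hA : CycleProdsLeOne A)
    (i : Fin n) : 1 ≤ mStar A i i := by
  simpa [mPow, mId] using mStar_le hA 0 i i

theorem mStar_le_of_span {n : ℕ} {A B : Matrix (Fin n) (Fin n) ℝ≥0}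
    (hA : CycleProdsLeOne A) (hB : CycleProdsLeOne B)
    (h : {v | ∃ x : Fin n → ℝ≥0, v = mMulVec (mStar A) x} ⊆
        {v | ∃ x : Fin n → ℝ≥0, v = mMulVec (mStar B) x}) (i j : Fin n) :
    mStar B i j ≤ mStar A i j := by
  have hm : (fun i => mStar A i j) ∈ {v | ∃ x : Fin n → ℝ≥0, v = mMulVec (mStar A) x} := by
    refine ⟨fun k => if k = j then 1 else 0, ?_⟩
    funext i
    apply le_antisymm
    · refine le_trans ?_ (Finset.le_sup (Finset.mem_univ j))
      simp
    · refine Finset.sup_le fun k _ => ?_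
      by_cases hk : k = j <;> simp [hk]
  obtain ⟨x, hx⟩ := h hm
  have hx' : ∀ i, mStar A i j = Finset.univ.sup fun k => mStar B i k * x k := fun i => congrFun hx i
  calc mStar B i j = mStar B i j * 1 := (mul_one _).symm
    _ ≤ mStar B i j * mStar A j j := mul_le_mul' le_rfl (one_le_mStar hA j)
    _ ≤ mStar A i j := by
      rw [hx' j, hx' i, NNReal.mul_finset_sup]
      refine Finset.sup_le fun k _ => ?_
      rw [← mul_assoc]
      exact (mul_le_mul' (mStar_mul hB i j k) le_rfl).trans
        (Finset.le_sup (f := fun k => mStar B i k * x k) (Finset.mem_univ k))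

/-- Kleene stars and column spans: for `A`, `B` with all cycle products `≤ 1`,
`A* = B*` iff the column spans of `A*` and `B*` coincide. -/
theorem kleene_star_eq_iff_column_spans_eq (n : ℕ) (hn : 1 ≤ n)
    (A B : Matrix (Fin n) (Fin n) ℝ≥0)
    (hA : CycleProdsLeOne A) (hB : CycleProdsLeOne B) :
    mStar A = mStar B ↔
      {v | ∃ x : Fin n → ℝ≥0, v = mMulVec (mStar A) x} =
        {v | ∃ x : Fin n → ℝ≥0, v = mMulVec (mStar B) x} := by
  constructor
  · intro h
    rw [h]
  · intro h
    funext i j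
    exact le_antisymm (mStar_le_of_span hB hA h.symm.subset i j)
      (mStar_le_of_span hA hB h.subset i j)
end

section
/- The definite form of a matrix is definite: Let n ≥ 1, let A be an n×n matrix over ℝ≥0, and let σ be a maximal permutation of A, i.e. the weight w(σ) = ∏_{i=1}^{n} A_{i σ(i)} is nonzero and w(σ) ≥ w(τ) for every permutation τ of {1,…,n}. Define the definite form A^σ of A as the n×n matrix with entries (A^σ)_{σ(l), j} = A_{l j} / A_{l σ(l)} for all l, j (equivalently A^σ = (D^σ)⁻¹ ⊙ A, where D^σ has entries D_{i σ(i)} = A_{i σ(i)} and 0 elsewhere). Then A^σ is definite: all diagonal entries of A^σ equal 1 and every cycle product of A^σ is at most 1. -/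
open scoped NNReal

/-- The definite form `A^σ` of `A` associated with a permutation `σ`:
`(A^σ)_{σ(l), j} = A_{l j} / A_{l σ(l)}`. -/
noncomputable def defForm {n : ℕ} (A : Matrix (Fin n) (Fin n) ℝ≥0)
    (σ : Equiv.Perm (Fin n)) : Matrix (Fin n) (Fin n) ℝ≥0 :=
  fun i j => A (σ.symm i) j / A (σ.symm i) i

/-- Cycle product bound for an injective cyclic sequence. -/
lemma cyc_inj {n : ℕ} (B : Matrix (Fin n) (Fin n) ℝ≥0) (hd : ∀ i, B i i = 1)
    (hp : ∀ τ : Equiv.Perm (Fin n), ∏ i, B i (τ i) ≤ 1)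
    (k : ℕ) (p : Fin (k + 1) → Fin n) (hinj : Function.Injective p) :
    (∏ l : Fin (k + 1), B (p l) (p (l + 1))) ≤ 1 := by
  classical
  let τ : Equiv.Perm (Fin n) := (finRotate (k + 1)).extendDomain (Equiv.ofInjective p hinj)
  have h1 : ∀ l, τ (p l) = p (l + 1) := by
    intro l
    have := Equiv.Perm.extendDomain_apply_image (finRotate (k + 1)) (Equiv.ofInjective p hinj) l
    simpa [τ] using this
  have h2 : ∀ i, i ∉ Set.range p → τ i = i := fun i hi =>
    Equiv.Perm.extendDomain_apply_not_subtype _ _ hi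
  have h3 : ∏ i, B i (τ i) = ∏ l, B (p l) (p (l + 1)) := by
    rw [← Finset.prod_subset (Finset.subset_univ (Finset.univ.image p))]
    · rw [Finset.prod_image (fun a _ b _ h => hinj h)]
      simp only [h1]
    · intro i _ hi
      rw [h2 i (by simpa using hi), hd]
  rw [← h3]
  exact hp τ

/-- Cycle product bound for closed walks indexed by the naturals. -/
lemma cyc_walk {n : ℕ} (B : Matrix (Fin n) (Fin n) ℝ≥0) (hd : ∀ i, B i i = 1)
    (hp : ∀ τ : Equiv.Perm (Fin n), ∏ i, B i (τ i) ≤ 1) (k : ℕ) :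
    ∀ q : ℕ → Fin n, q k = q 0 → ∏ i ∈ Finset.range k, B (q i) (q (i + 1)) ≤ 1 := by
  induction k using Nat.strong_induction_on with
  | _ k ih =>
  intro q hq
  by_cases hinj : ∃ a b, a < b ∧ b < k ∧ q a = q b
  · obtain ⟨a, b, hab, hbk, hqab⟩ := hinj
    obtain ⟨d, rfl⟩ := Nat.exists_eq_add_of_lt hab
    obtain ⟨e, rfl⟩ := Nat.exists_eq_add_of_lt hbk
    have e1 := ih (d + 1) (by omega) (fun i => q (a + i)) (by
      simpa [add_assoc] using hqab.symm)
    have e2 := ih (a + (e + 1)) (by omega) (fun i => if i ≤ a then q i else q (i + (d + 1))) (by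
      simp only [Nat.zero_le, if_true]
      rw [if_neg (by omega), ← hq]
      congr 1; omega)
    rw [Finset.prod_range_add] at e2
    rw [show a + d + 1 + e + 1 = a + ((d + 1) + (e + 1)) by ring, Finset.prod_range_add,
      Finset.prod_range_add]
    have f1 : ∏ x ∈ Finset.range a, B (if x ≤ a then q x else q (x + (d + 1)))
        (if x + 1 ≤ a then q (x + 1) else q (x + 1 + (d + 1)))
        = ∏ x ∈ Finset.range a, B (q x) (q (x + 1)) := by
      refine Finset.prod_congr rfl fun x hx => ?_
      have := Finset.mem_range.1 hx
      rw [if_pos (by omega), if_pos (by omega)]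
    have f2 : ∏ x ∈ Finset.range (e + 1), B (if a + x ≤ a then q (a + x) else q (a + x + (d + 1)))
        (if a + x + 1 ≤ a then q (a + x + 1) else q (a + x + 1 + (d + 1)))
        = ∏ x ∈ Finset.range (e + 1), B (q (a + (d + 1 + x))) (q (a + (d + 1 + x) + 1)) := by
      refine Finset.prod_congr rfl fun x hx => ?_
      rw [if_neg (by omega : ¬ a + x + 1 ≤ a),
        show a + x + 1 + (d + 1) = a + (d + 1 + x) + 1 by ring]
      congr 1
      split_ifs with h
      · obtain rfl : x = 0 := by omega
        simpa [add_assoc] using hqab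
      · congr 1; ring
    rw [f1, f2] at e2
    rw [mul_left_comm]
    exact mul_le_one' e1 e2
  · cases k with
    | zero => simp
    | succ m =>
      have := cyc_inj B hd hp m (fun i => q i) (by
        intro i j hij
        by_contra hne
        rcases lt_or_gt_of_ne hne with h | h
        · exact hinj ⟨i, j, h, j.2, hij⟩
        · exact hinj ⟨j, i, h, i.2, hij.symm⟩)
      rw [← Fin.prod_univ_eq_prod_range (fun i => B (q i) (q (i + 1)))]
      refine le_of_eq_of_le (Finset.prod_congr rfl fun l _ => ?_) this
      congr 1
      rw [Fin.val_add_one]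
      split_ifs with h
      · subst h; simpa using hq
      · rfl

/-- The definite form of a matrix with respect to a maximal permutation is definite:
if `σ` has nonzero weight `∏ i, A_{i σ(i)}` that is maximal among all permutations,
then `A^σ` has unit diagonal and all its cycle products are `≤ 1`. -/
theorem definite_form_is_definite (n : ℕ) (hn : 1 ≤ n)
    (A : Matrix (Fin n) (Fin n) ℝ≥0) (σ : Equiv.Perm (Fin n))
    (hne : (∏ i, A i (σ i)) ≠ 0)
    (hmax : ∀ τ : Equiv.Perm (Fin n), (∏ i, A i (τ i)) ≤ ∏ i, A i (σ i)) :
    (∀ i, defForm A σ i i = 1) ∧ CycleProdsLeOne (defForm A σ) := by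
  have hA : ∀ i, A i (σ i) ≠ 0 := fun i => Finset.prod_ne_zero_iff.1 hne i (Finset.mem_univ i)
  have hd : ∀ i, defForm A σ i i = 1 := by
    intro i
    have := hA (σ.symm i)
    rw [Equiv.apply_symm_apply] at this
    exact div_self this
  have hp : ∀ τ : Equiv.Perm (Fin n), ∏ i, defForm A σ i (τ i) ≤ 1 := by
    intro τ
    rw [← Equiv.prod_comp σ]
    simp only [defForm, Equiv.symm_apply_apply]
    rw [Finset.prod_div_distrib]
    exact div_le_one_of_le₀ (hmax (σ.trans τ)) zero_le
  refine ⟨hd, fun k p => ?_⟩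
  have := cyc_walk _ hd hp (k + 1) (fun i => p (Fin.ofNat (k + 1) i)) (by
    congr 1; ext; simp)
  rw [← Fin.prod_univ_eq_prod_range
    (fun i => defForm A σ (p (Fin.ofNat (k + 1) i)) (p (Fin.ofNat (k + 1) (i + 1))))] at this
  refine le_of_eq_of_le (Finset.prod_congr rfl fun l _ => ?_) this
  have h1 : Fin.ofNat (k + 1) (l : ℕ) = l := by
    ext; simp
  have h2 : Fin.ofNat (k + 1) ((l : ℕ) + 1) = l + 1 := by
    ext; simp [Fin.val_add]
  rw [h1, h2]
end

section
/- The definite closure is well defined: Let n ≥ 1, let A be an n×n matrix over ℝ≥0 possessing a permutation of nonzero weight, and let σ and τ both be maximal permutations of A. Then the Kleene stars of the corresponding definite forms coincide: (A^σ)* = (A^τ)*. (In particular the definite closure of A, defined as ((D^σ)⁻¹ ⊙ A)* for a maximal permutation σ, does not depend on the choice of maximal permutation.) -/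
open scoped NNReal

open scoped NNReal

lemma mProd_le_aux {n : ℕ} (A B : Matrix (Fin n) (Fin n) ℝ≥0) (i k j : Fin n) :
    A i k * B k j ≤ mProd A B i j :=
  Finset.le_sup (f := fun k => A i k * B k j) (Finset.mem_univ k)

lemma mPow_add_aux {n : ℕ} (B : Matrix (Fin n) (Fin n) ℝ≥0) (a b : ℕ) :
    ∀ i l j : Fin n, mPow B a i l * mPow B b l j ≤ mPow B (a + b) i j := by
  induction a with
  | zero =>
    intro i l j
    by_cases h : i = l
    · subst h; simp [mPow, mId]
    · simp [mPow, mId, h]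
  | succ a ih =>
    intro i l j
    have : Finset.univ.Nonempty := ⟨i, Finset.mem_univ i⟩
    obtain ⟨k, -, hk⟩ := Finset.exists_mem_eq_sup Finset.univ this
      (fun k => B i k * mPow B a k l)
    have h1 : mPow B (a + 1) i l = B i k * mPow B a k l := hk
    rw [h1, mul_assoc, show a + 1 + b = (a + b) + 1 by omega]
    exact (mul_le_mul_right (ih k l j) _).trans (mProd_le_aux B (mPow B (a + b)) i k j)

lemma le_mPow_one_aux {n : ℕ} (B : Matrix (Fin n) (Fin n) ℝ≥0) (i j : Fin n) :
    B i j ≤ mPow B 1 i j := by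
  have h := mProd_le_aux B (mPow B 0) i j j
  simpa [mPow, mId] using h

lemma mPow_cofinal_aux {n : ℕ} (B C : Matrix (Fin n) (Fin n) ℝ≥0)
    (h : ∀ i j, ∃ m, C i j ≤ mPow B m i j) (k : ℕ) :
    ∀ i j, ∃ m, mPow C k i j ≤ mPow B m i j := by
  induction k with
  | zero => intro i j; exact ⟨0, le_rfl⟩
  | succ k ih =>
    intro i j
    have : Finset.univ.Nonempty := ⟨i, Finset.mem_univ i⟩
    obtain ⟨l, -, hl⟩ := Finset.exists_mem_eq_sup Finset.univ this
      (fun l => C i l * mPow C k l j)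
    have h1 : mPow C (k + 1) i j = C i l * mPow C k l j := hl
    obtain ⟨a, ha⟩ := h i l
    obtain ⟨b, hb⟩ := ih l j
    exact ⟨a + b, h1 ▸ (mul_le_mul' ha hb).trans (mPow_add_aux B a b i l j)⟩

lemma iSup_cofinal_aux (f g : ℕ → ℝ≥0) (h1 : ∀ k, ∃ m, f k ≤ g m)
    (h2 : ∀ k, ∃ m, g k ≤ f m) : (⨆ k, f k) = ⨆ k, g k := by
  have key : ∀ f g : ℕ → ℝ≥0, (∀ k, ∃ m, f k ≤ g m) → BddAbove (Set.range g) →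
      BddAbove (Set.range f) ∧ (⨆ k, f k) ≤ ⨆ k, g k := by
    intro f g h hb
    have h' : ∀ k, f k ≤ ⨆ k, g k := fun k => by
      obtain ⟨m, hm⟩ := h k
      exact hm.trans (le_ciSup hb m)
    exact ⟨⟨_, by rintro _ ⟨k, rfl⟩; exact h' k⟩, ciSup_le h'⟩
  by_cases hb : BddAbove (Set.range g)
  · obtain ⟨hf, h⟩ := key f g h1 hb
    exact le_antisymm h (key g f h2 hf).2
  · have hf : ¬ BddAbove (Set.range f) := fun hf => hb (key g f h2 hf).1
    rw [iSup, iSup, NNReal.sSup_of_not_bddAbove hb, NNReal.sSup_of_not_bddAbove hf]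

lemma cycle_aux {n : ℕ} (A : Matrix (Fin n) (Fin n) ℝ≥0) (σ τ : Equiv.Perm (Fin n))
    (hσ : ∀ i, A i (σ i) ≠ 0) (hτ : ∀ i, A i (τ i) ≠ 0)
    (hτmax : ∀ ρ : Equiv.Perm (Fin n), (∏ i, A i (ρ i)) ≤ ∏ i, A i (τ i)) (i : Fin n) :
    ∃ r : ℕ, ((σ * τ⁻¹) ^ (r + 1)) i = i ∧
      1 ≤ ∏ s ∈ Finset.range (r + 1),
        defForm A σ ((σ * τ⁻¹) (((σ * τ⁻¹) ^ s) i)) (((σ * τ⁻¹) ^ s) i) := by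
  classical
  set π := σ * τ⁻¹ with hπ
  set f : Fin n → ℝ≥0 := fun k => defForm A σ (π k) k with hf
  let S : Finset (Fin n) := Finset.univ.filter (fun k => π.SameCycle i k)
  have hmem : ∀ k, k ∈ S ↔ π.SameCycle i k := fun k => by simp [S]
  have hiS : i ∈ S := by rw [hmem]
  have hc : π.IsCycleOn (S : Set (Fin n)) := by
    refine ⟨⟨fun k hk => ?_, π.injective.injOn, fun k hk => ⟨π.symm k, ?_, by simp⟩⟩, ?_⟩
    · simp only [Finset.mem_coe, hmem] at hk ⊢
      exact Equiv.Perm.sameCycle_apply_right.2 hk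
    · simp only [Finset.mem_coe, hmem] at hk ⊢
      rw [← Equiv.Perm.sameCycle_apply_right]; simpa using hk
    · intro x hx y hy
      simp only [Finset.mem_coe, hmem] at hx hy
      exact hx.symm.trans hy
  have hpos : 0 < S.card := Finset.card_pos.2 ⟨i, hiS⟩
  obtain ⟨r, hr⟩ : ∃ r, S.card = r + 1 := ⟨S.card - 1, by omega⟩
  refine ⟨r, ?_, ?_⟩
  · rw [← hr]; exact hc.pow_card_apply hiS
  have himg : (Finset.range (r + 1)).image (fun s => (π ^ s) i) = S := by
    ext k
    rw [Finset.mem_image]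
    constructor
    · rintro ⟨s, -, rfl⟩
      rw [hmem]
      exact Equiv.Perm.sameCycle_pow_right.2 (Equiv.Perm.SameCycle.refl _ _)
    · intro hk
      obtain ⟨s, hs, h⟩ := hc.exists_pow_eq hiS hk
      exact ⟨s, by rw [Finset.mem_range]; omega, h⟩
  have hinj : Set.InjOn (fun s => (π ^ s) i) (Finset.range (r + 1) : Finset ℕ) := by
    apply Finset.card_image_iff.1
    rw [himg, hr, Finset.card_range]
  have hprod : ∏ s ∈ Finset.range (r + 1), f ((π ^ s) i) = ∏ k ∈ S, f k := by
    rw [← himg, Finset.prod_image hinj]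
  change 1 ≤ ∏ s ∈ Finset.range (r + 1), f ((π ^ s) i)
  rw [hprod]
  -- compare with the permutation equal to σ on the cycle and τ elsewhere
  have hmax := hτmax (π.cycleOf i * τ)
  have hre : ∀ ρ : Equiv.Perm (Fin n), ∏ l, A l ((ρ * τ) l) = ∏ k, A (τ.symm k) (ρ k) := by
    intro ρ
    rw [← Equiv.prod_comp τ (fun k => A (τ.symm k) (ρ k))]
    simp
  have h1 := hre 1
  rw [one_mul] at h1
  rw [hre, h1] at hmax
  have hA : ∀ k, A (τ.symm k) k ≠ 0 := fun k => by simpa using hτ (τ.symm k)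
  have hB : ∀ k, A (τ.symm k) (π k) ≠ 0 := fun k => by
    simpa [hπ, Equiv.Perm.inv_def] using hσ (τ.symm k)
  have hfk : ∀ k, f k = A (τ.symm k) k / A (τ.symm k) (π k) := fun k => by
    simp [hf, defForm, hπ, Equiv.Perm.inv_def]
  have h2 : ∏ k, A (τ.symm k) k =
      (∏ k ∈ S, f k) * ∏ k, A (τ.symm k) (π.cycleOf i k) := by
    rw [← Finset.prod_filter_mul_prod_filter_not Finset.univ (fun k => π.SameCycle i k)
      (fun k => A (τ.symm k) k),
      ← Finset.prod_filter_mul_prod_filter_not Finset.univ (fun k => π.SameCycle i k)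
      (fun k => A (τ.symm k) (π.cycleOf i k)), ← mul_assoc, ← Finset.prod_mul_distrib]
    congr 1
    · refine Finset.prod_congr rfl fun k hk => ?_
      have hk' := (Finset.mem_filter.1 hk).2
      rw [hk'.cycleOf_apply, hfk, div_mul_cancel₀ _ (hB k)]
    · refine Finset.prod_congr rfl fun k hk => ?_
      have hk' := (Finset.mem_filter.1 hk).2
      rw [Equiv.Perm.cycleOf_apply_of_not_sameCycle hk']
  have h3 : (∏ k, A (τ.symm k) (π.cycleOf i k)) ≠ 0 := by
    intro h0
    rw [h0, mul_zero] at h2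
    exact Finset.prod_ne_zero_iff.2 (fun k _ => hA k) h2
  simp only [Equiv.Perm.one_apply] at hmax
  rw [h2] at hmax
  exact (le_mul_iff_one_le_left (pos_iff_ne_zero.2 h3)).1 hmax

lemma defForm_le_aux {n : ℕ} (A : Matrix (Fin n) (Fin n) ℝ≥0) (σ τ : Equiv.Perm (Fin n))
    (hσ : ∀ i, A i (σ i) ≠ 0) (hτ : ∀ i, A i (τ i) ≠ 0)
    (hτmax : ∀ ρ : Equiv.Perm (Fin n), (∏ i, A i (ρ i)) ≤ ∏ i, A i (τ i)) (i j : Fin n) :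
    ∃ m, defForm A τ i j ≤ mPow (defForm A σ) m i j := by
  obtain ⟨r, hr, hprod⟩ := cycle_aux A σ τ hσ hτ hτmax i
  set π := σ * τ⁻¹ with hπ
  set B := defForm A σ with hBdef
  have hpath : ∀ t : ℕ, ∏ s ∈ Finset.range t, B (π ((π ^ (s + 1)) i)) ((π ^ (s + 1)) i) ≤
      mPow B t ((π ^ (t + 1)) i) (π i) := by
    intro t
    induction t with
    | zero => simp [mPow, mId]
    | succ t ih =>
      rw [Finset.prod_range_succ, mul_comm, pow_succ' π (t + 1), Equiv.Perm.mul_apply]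
      exact (mul_le_mul_right ih _).trans (mProd_le_aux B (mPow B t) _ _ _)
  have hp := hpath r
  rw [hr] at hp
  rw [Finset.prod_range_succ'] at hprod
  simp only [pow_zero, Equiv.Perm.one_apply] at hprod
  have hA : A (τ.symm i) i ≠ 0 := by simpa using hτ (τ.symm i)
  have hB : A (τ.symm i) (π i) ≠ 0 := by
    simpa [hπ, Equiv.Perm.inv_def] using hσ (τ.symm i)
  have hf : ∀ k, B (π i) k = A (τ.symm i) k / A (τ.symm i) (π i) := fun k => by
    simp [hBdef, defForm, hπ, Equiv.Perm.inv_def]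
  have hC : defForm A τ i j * B (π i) i = B (π i) j := by
    rw [hf, hf, defForm]; field_simp
  refine ⟨r + 1, ?_⟩
  calc defForm A τ i j ≤ defForm A τ i j * (mPow B r i (π i) * B (π i) i) :=
        le_mul_of_one_le_right' (hprod.trans (mul_le_mul_left hp _))
    _ = mPow B r i (π i) * B (π i) j := by rw [← hC]; ring
    _ ≤ mPow B r i (π i) * mPow B 1 (π i) j := mul_le_mul_right (le_mPow_one_aux B _ _) _
    _ ≤ mPow B (r + 1) i j := mPow_add_aux B r 1 _ _ _

/-- The definite closure is well defined: if `σ` and `τ` are both maximal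
permutations of `A` (nonzero weight, maximal among all permutations), then the
Kleene stars of the corresponding definite forms coincide: `(A^σ)* = (A^τ)*`. -/
theorem definite_closure_well_defined (n : ℕ) (hn : 1 ≤ n)
    (A : Matrix (Fin n) (Fin n) ℝ≥0) (σ τ : Equiv.Perm (Fin n))
    (hσne : (∏ i, A i (σ i)) ≠ 0)
    (hσmax : ∀ ρ : Equiv.Perm (Fin n), (∏ i, A i (ρ i)) ≤ ∏ i, A i (σ i))
    (hτne : (∏ i, A i (τ i)) ≠ 0)
    (hτmax : ∀ ρ : Equiv.Perm (Fin n), (∏ i, A i (ρ i)) ≤ ∏ i, A i (τ i)) :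
    mStar (defForm A σ) = mStar (defForm A τ) := by
  have hσ : ∀ i, A i (σ i) ≠ 0 := fun i => Finset.prod_ne_zero_iff.1 hσne i (Finset.mem_univ i)
  have hτ : ∀ i, A i (τ i) ≠ 0 := fun i => Finset.prod_ne_zero_iff.1 hτne i (Finset.mem_univ i)
  funext i j
  exact iSup_cofinal_aux _ _
    (fun k => mPow_cofinal_aux _ _ (defForm_le_aux A τ σ hτ hσ hσmax) k i j)
    (fun k => mPow_cofinal_aux _ _ (defForm_le_aux A σ τ hσ hτ hτmax) k i j)
end

section
/- Busemann points of a finite-dimensional normed space: Let V be a finite-dimensional real normed vector space with basepoint 0, and let B° = {q ∈ V* : ‖q‖ ≤ 1} be the unit ball of the dual space V* (continuous linear functionals with the operator norm). A function h : V → ℝ is a Busemann point of V if and only if there exist a proper extreme set E of B° (i.e. a nonempty extreme subset E of B° with E ≠ B°) and a point p ∈ V such that h(x) = sup_{q∈E} q(x−p) + inf_{y∈E} y(p) for all x ∈ V. -/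
open Filter Topology

/-- `φ_z(x) = ‖x - z‖ - ‖z‖`, the normalized distance function with basepoint `0`. -/
noncomputable def phiPt {V : Type*} [NormedAddCommGroup V] (z x : V) : ℝ :=
  ‖x - z‖ - ‖z‖

/-- `h` is a horofunction of the normed space `V` (with basepoint `0`): `h` is a limit,
uniformly on compact subsets, of functions `φ_{zₙ}` for some sequence `zₙ` in `V`, and
`h` is not of the form `φ_z`. -/
def IsHorofunction (V : Type*) [NormedAddCommGroup V] (h : V → ℝ) : Prop :=
  (∃ z : ℕ → V, ∀ K : Set V, IsCompact K →
    TendstoUniformlyOn (fun n x => phiPt (z n) x) h atTop K) ∧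
  ∀ z : V, h ≠ phiPt z

/-- `γ : T → V` is an almost-geodesic: `T ⊆ [0,∞)` is unbounded, `0 ∈ T`, and for every
`ε > 0` there is `s₀` with `|‖γ(t)-γ(s)‖ + ‖γ(s)-γ(0)‖ - t| < ε` for all
`s, t ∈ T` with `s₀ ≤ s ≤ t`. -/
def IsAlmostGeodesic {V : Type*} [NormedAddCommGroup V] (T : Set ℝ) (γ : ℝ → V) : Prop :=
  T ⊆ Set.Ici 0 ∧ (0 : ℝ) ∈ T ∧ ¬BddAbove T ∧
  ∀ ε > (0 : ℝ), ∃ s₀ : ℝ, ∀ s ∈ T, ∀ t ∈ T, s₀ ≤ s → s ≤ t →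
    |‖γ t - γ s‖ + ‖γ s - γ 0‖ - t| < ε

/-- `h` is a Busemann point of `V`: a horofunction which is the limit, uniformly on
compact sets along `t → ∞` in `T`, of `φ_{γ(t)}` for some almost-geodesic `γ`. -/
def IsBusemannPoint (V : Type*) [NormedAddCommGroup V] (h : V → ℝ) : Prop :=
  IsHorofunction V h ∧
  ∃ (T : Set ℝ) (γ : ℝ → V), IsAlmostGeodesic T γ ∧
    ∀ K : Set V, IsCompact K →
      TendstoUniformlyOn (fun t x => phiPt (γ t) x) h (atTop ⊓ Filter.principal T) K

/-- support function -/
noncomputable def suppF {V : Type*} [NormedAddCommGroup V] [NormedSpace ℝ V]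
    (E : Set (V →L[ℝ] ℝ)) (x : V) : ℝ := sSup ((fun q : V →L[ℝ] ℝ => q x) '' E)

section aux
variable {V : Type*} [NormedAddCommGroup V] [NormedSpace ℝ V]

lemma ball_apply_le {q : V →L[ℝ] ℝ} (hq : q ∈ Metric.closedBall (0 : V →L[ℝ] ℝ) 1) (x : V) :
    q x ≤ ‖x‖ := by
  rw [mem_closedBall_zero_iff] at hq
  calc q x ≤ ‖q x‖ := Real.le_norm_self _
    _ ≤ ‖q‖ * ‖x‖ := q.le_opNorm x
    _ ≤ 1 * ‖x‖ := by gcongr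
    _ = ‖x‖ := one_mul _

lemma ball_neg_le_apply {q : V →L[ℝ] ℝ} (hq : q ∈ Metric.closedBall (0 : V →L[ℝ] ℝ) 1) (x : V) :
    -‖x‖ ≤ q x := by
  have := ball_apply_le hq (-x)
  rw [norm_neg, map_neg] at this
  linarith

lemma suppF_bdd {E : Set (V →L[ℝ] ℝ)} (hE : E ⊆ Metric.closedBall 0 1) (x : V) :
    BddAbove ((fun q : V →L[ℝ] ℝ => q x) '' E) := by
  refine ⟨‖x‖, ?_⟩
  rintro _ ⟨q, hq, rfl⟩
  exact ball_apply_le (hE hq) x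

lemma le_suppF {E : Set (V →L[ℝ] ℝ)} (hE : E ⊆ Metric.closedBall 0 1) (x : V)
    {q : V →L[ℝ] ℝ} (hq : q ∈ E) : q x ≤ suppF E x :=
  le_csSup (suppF_bdd hE x) ⟨q, hq, rfl⟩

lemma suppF_le {E : Set (V →L[ℝ] ℝ)} (hne : E.Nonempty) (x : V) {M : ℝ}
    (h : ∀ q ∈ E, q x ≤ M) : suppF E x ≤ M := by
  refine csSup_le (hne.image _) ?_
  rintro _ ⟨q, hq, rfl⟩
  exact h q hq

lemma suppF_neg (E : Set (V →L[ℝ] ℝ)) (p : V) :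
    sInf ((fun y : V →L[ℝ] ℝ => y p) '' E) = - suppF E (-p) := by
  rw [Real.sInf_def, suppF]
  congr 2
  ext r
  simp only [Set.mem_neg, Set.mem_image, map_neg]
  constructor
  · rintro ⟨q, hq, h⟩; exact ⟨q, hq, by linarith⟩
  · rintro ⟨q, hq, h⟩; exact ⟨q, hq, by linarith⟩

lemma suppF_ball (x : V) : suppF (Metric.closedBall (0 : V →L[ℝ] ℝ) 1) x = ‖x‖ := by
  apply le_antisymm
  · exact suppF_le ⟨0, by simp⟩ x (fun q hq => ball_apply_le hq x)
  · obtain ⟨g, hg, hgx⟩ := exists_dual_vector'' ℝ x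
    have := le_suppF (E := Metric.closedBall (0 : V →L[ℝ] ℝ) 1) subset_rfl x (q := g) (by simpa using hg)
    rw [hgx] at this
    simpa using this

lemma bidual_rep [FiniteDimensional ℝ V] (f : (V →L[ℝ] ℝ) →ₗ[ℝ] ℝ) : ∃ v : V, ∀ q, f q = q v := by
  let F : Module.Dual ℝ (Module.Dual ℝ V) :=
    f ∘ₗ (LinearMap.toContinuousLinearMap (𝕜 := ℝ) (E := V) (F' := ℝ)).toLinearMap
  refine ⟨(Module.evalEquiv ℝ V).symm F, fun q => ?_⟩
  have := Module.apply_evalEquiv_symm_apply (R := ℝ) (M := V) (q : V →ₗ[ℝ] ℝ) F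
  have h2 : F (q : V →ₗ[ℝ] ℝ) = f q := by
    simp only [F, LinearMap.comp_apply]
    congr 1
  rw [← h2, ← this]
  rfl

/-- almost monotone bounded sequences converge -/
lemma almost_mono_tendsto (a : ℕ → ℝ)
    (hmono : ∀ ε > (0:ℝ), ∃ N, ∀ n ≥ N, ∀ m ≥ n, a n ≤ a m + ε)
    (hb : ∃ M, ∀ᶠ n in atTop, a n ≤ M) : ∃ l, Tendsto a atTop (𝓝 l) := by
  obtain ⟨M, hM⟩ := hb
  have hbu : IsBoundedUnder (· ≤ ·) atTop a := ⟨M, by simpa using hM⟩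
  have hbl : IsBoundedUnder (· ≥ ·) atTop a := by
    obtain ⟨N, hN⟩ := hmono 1 one_pos
    refine ⟨a N - 1, ?_⟩
    rw [eventually_map]
    filter_upwards [eventually_ge_atTop N] with n hn
    have := hN N le_rfl n hn
    show a N - 1 ≤ a n
    linarith
  refine ⟨liminf a atTop, tendsto_of_le_liminf_of_limsup_le le_rfl ?_ hbu hbl⟩
  refine le_of_forall_pos_le_add fun ε hε => ?_
  obtain ⟨N, hN⟩ := hmono ε hε
  refine limsup_le_of_le hbl.isCoboundedUnder_le ?_
  filter_upwards [eventually_ge_atTop N] with n hn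
  have : a n - ε ≤ liminf a atTop := by
    refine le_liminf_of_le hbu.isCoboundedUnder_ge ?_
    filter_upwards [eventually_ge_atTop n] with m hm
    linarith [hN n hn m hm]
  linarith

lemma limit_rep [FiniteDimensional ℝ V] (z : ℕ → V) :
    ∃ p : V, ∀ f : V →L[ℝ] ℝ, ∀ l, Tendsto (fun n => f (z n)) atTop (𝓝 l) → l = f p := by
  let W : Submodule ℝ (V →L[ℝ] ℝ) :=
    { carrier := {f | ∃ l, Tendsto (fun n => f (z n)) atTop (𝓝 l)}
      add_mem' := by
        rintro f g ⟨l, hl⟩ ⟨m, hm⟩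
        exact ⟨l + m, by simpa using hl.add hm⟩
      zero_mem' := ⟨0, by simp⟩
      smul_mem' := by
        rintro c f ⟨l, hl⟩
        exact ⟨c * l, by simpa using hl.const_mul c⟩ }
  have hW : ∀ f : W, ∃ l, Tendsto (fun n => f.1 (z n)) atTop (𝓝 l) := fun f => f.2
  choose L hL using hW
  let L' : W →ₗ[ℝ] ℝ :=
    { toFun := L
      map_add' := fun f g => tendsto_nhds_unique (hL (f + g)) (by simpa using (hL f).add (hL g))
      map_smul' := fun c f =>
        tendsto_nhds_unique (hL (c • f)) (by simpa using (hL f).const_mul c) }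
  obtain ⟨g, hg⟩ := LinearMap.exists_extend L'
  obtain ⟨p, hp⟩ := bidual_rep g
  refine ⟨p, fun f l hl => ?_⟩
  have hf : f ∈ W := ⟨l, hl⟩
  have h1 : l = L ⟨f, hf⟩ := tendsto_nhds_unique hl (hL ⟨f, hf⟩)
  have h2 : g f = L ⟨f, hf⟩ := by
    have := congrArg (fun k => k ⟨f, hf⟩) hg
    simpa [L'] using this
  rw [h1, ← h2, hp]

/-- The key analytic statement for the forward direction. -/
lemma forward_core [FiniteDimensional ℝ V] (H : V → ℝ) (z : ℕ → V) (t : ℕ → ℝ)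
    (hmono : ∀ ε > (0:ℝ), ∃ N, ∀ n ≥ N, ∀ m ≥ n, ‖z n - z m‖ + t n - t m ≤ ε)
    (hlim : ∀ x, Tendsto (fun n => ‖x - z n‖ - t n) atTop (𝓝 (H x))) :
    ∃ (E : Set (V →L[ℝ] ℝ)) (p : V) (κ : ℝ), E.Nonempty ∧ Convex ℝ E ∧
      IsExtreme ℝ (Metric.closedBall 0 1) E ∧ ∀ x, H x = suppF E (x - p) - κ := by
  set g : ℕ → (V →L[ℝ] ℝ) → ℝ := fun n q => q (z n) + t n with hg
  have gm : ∀ ε > (0:ℝ), ∃ N, ∀ n ≥ N, ∀ m ≥ n, ∀ q ∈ Metric.closedBall (0 : V →L[ℝ] ℝ) 1,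
      g n q ≤ g m q + ε := by
    intro ε hε
    obtain ⟨N, hN⟩ := hmono ε hε
    refine ⟨N, fun n hn m hm q hq => ?_⟩
    have h1 := hN n hn m hm
    have h2 := ball_apply_le hq (z n - z m)
    rw [map_sub] at h2
    simp only [hg]
    linarith
  set E : Set (V →L[ℝ] ℝ) := {q | q ∈ Metric.closedBall (0 : V →L[ℝ] ℝ) 1 ∧
    ∃ M, ∀ᶠ n in atTop, g n q ≤ M} with hE
  have gl : ∀ q ∈ Metric.closedBall (0 : V →L[ℝ] ℝ) 1, ∃ M, ∀ᶠ n in atTop, M ≤ g n q := by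
    intro q hq
    obtain ⟨N, hN⟩ := gm 1 one_pos
    refine ⟨g N q - 1, ?_⟩
    filter_upwards [eventually_ge_atTop N] with n hn
    linarith [hN N le_rfl n hn q hq]
  have gG : ∀ q ∈ E, ∃ l, Tendsto (fun n => g n q) atTop (𝓝 l) := by
    intro q hq
    refine almost_mono_tendsto _ ?_ hq.2
    intro ε hε
    obtain ⟨N, hN⟩ := gm ε hε
    exact ⟨N, fun n hn m hm => hN n hn m hm q hq.1⟩
  choose! G hG using gG
  have hup : ∀ x, ∀ q ∈ E, q x - G q ≤ H x := by
    intro x q hq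
    refine le_of_tendsto_of_tendsto' ((hG q hq).const_sub (q x)) (hlim x) fun n => ?_
    have := ball_apply_le hq.1 (x - z n)
    rw [map_sub] at this
    simp only [hg]
    linarith
  have hlow : ∀ x, ∃ q ∈ E, H x ≤ q x - G q := by
    intro x
    have h1 : ∀ n, ∃ q ∈ Metric.closedBall (0 : V →L[ℝ] ℝ) 1, q (x - z n) = ‖x - z n‖ := by
      intro n
      obtain ⟨q, hq, hqx⟩ := exists_dual_vector'' ℝ (x - z n)
      exact ⟨q, by simpa using hq, by simpa using hqx⟩
    choose q hqB hq using h1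
    obtain ⟨qs, hqs, f, hf, hlimq⟩ :=
      (isCompact_closedBall (0 : V →L[ℝ] ℝ) 1).tendsto_subseq hqB
    have hev : ∀ y, Tendsto (fun k => q (f k) y) atTop (𝓝 (qs y)) := fun y =>
      (((ContinuousLinearMap.apply ℝ ℝ y).continuous.tendsto qs).comp hlimq)
    have key : ∀ ε > (0:ℝ), ∃ N, ∀ n ≥ N, g n qs ≤ qs x - H x + ε := by
      intro ε hε
      obtain ⟨N, hN⟩ := gm ε hε
      refine ⟨N, fun n hn => ?_⟩
      have hl : Tendsto (fun k => g n (q (f k))) atTop (𝓝 (g n qs)) := (hev (z n)).add_const _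
      have hr : Tendsto (fun k => q (f k) x - (‖x - z (f k)‖ - t (f k)) + ε) atTop
          (𝓝 (qs x - H x + ε)) :=
        ((hev x).sub ((hlim x).comp hf.tendsto_atTop)).add_const ε
      refine le_of_tendsto_of_tendsto hl hr ?_
      filter_upwards [eventually_ge_atTop n] with k hk
      have h2 := hN n hn (f k) (hk.trans (hf.id_le k)) (q (f k)) (hqB _)
      have h3 := hq (f k)
      rw [map_sub] at h3
      simp only [hg] at h2 ⊢
      linarith
    have hqE : qs ∈ E := by
      obtain ⟨N, hN⟩ := key 1 one_pos
      exact ⟨hqs, _, (eventually_ge_atTop N).mono hN⟩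
    refine ⟨qs, hqE, ?_⟩
    have : G qs ≤ qs x - H x := by
      refine le_of_forall_pos_le_add fun ε hε => ?_
      obtain ⟨N, hN⟩ := key ε hε
      exact le_of_tendsto (hG qs hqE) ((eventually_ge_atTop N).mono hN)
    linarith
  obtain ⟨p, hp⟩ := limit_rep z
  obtain ⟨q0, hq0, -⟩ := hlow 0
  have hGp : ∀ q ∈ E, G q = q p + (G q0 - q0 p) := by
    intro q hq
    have h1 : Tendsto (fun n => (q - q0) (z n)) atTop (𝓝 (G q - G q0)) := by
      refine ((hG q hq).sub (hG q0 hq0)).congr fun n => ?_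
      simp [hg]
    have := hp _ _ h1
    simp at this
    linarith
  have hEB : E ⊆ Metric.closedBall 0 1 := fun q hq => hq.1
  refine ⟨E, p, G q0 - q0 p, ⟨q0, hq0⟩, ?_, ⟨hEB, ?_⟩, ?_⟩
  · rintro q1 ⟨h1, M1, hM1⟩ q2 ⟨h2, M2, hM2⟩ a b ha hb hab
    refine ⟨convex_closedBall _ _ h1 h2 ha hb hab, a * M1 + b * M2, ?_⟩
    filter_upwards [hM1, hM2] with n hn1 hn2
    have : g n (a • q1 + b • q2) = a * g n q1 + b * g n q2 := by
      simp only [hg]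
      simp
      linear_combination - t n * hab
    rw [this]
    gcongr
  · rintro q1 h1 q2 h2 q ⟨-, M, hM⟩ ⟨a, b, ha, hb, hab, rfl⟩
    refine ⟨h1, ?_⟩
    obtain ⟨m, hm⟩ := gl q2 h2
    refine ⟨(M - b * m) / a, ?_⟩
    filter_upwards [hM, hm] with n hn1 hn2
    have : g n (a • q1 + b • q2) = a * g n q1 + b * g n q2 := by
      simp only [hg]
      simp
      linear_combination - t n * hab
    rw [this] at hn1
    rw [le_div_iff₀ ha]
    nlinarith
  · intro x
    apply le_antisymm
    · obtain ⟨q, hq, h⟩ := hlow x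
      have := le_suppF hEB (x - p) hq
      rw [hGp q hq] at h
      rw [map_sub] at this
      linarith
    · have : suppF E (x - p) ≤ H x + (G q0 - q0 p) := by
        refine suppF_le ⟨q0, hq0⟩ _ fun q hq => ?_
        have := hup x q hq
        rw [hGp q hq] at this
        rw [map_sub]
        linarith
      linarith

lemma forward [FiniteDimensional ℝ V] (h : V → ℝ) (hB : IsBusemannPoint V h) :
    ∃ (E : Set (V →L[ℝ] ℝ)) (p : V),
        E.Nonempty ∧ E ≠ Metric.closedBall 0 1 ∧ Convex ℝ E ∧
        IsExtreme ℝ (Metric.closedBall 0 1) E ∧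
        ∀ x : V, h x = suppF E (x - p) - suppF E (-p) := by
  obtain ⟨⟨-, hne⟩, T, γ, ⟨hT0, h0T, hTu, hag⟩, hunif⟩ := hB
  have hT : ∀ a : ℝ, ∃ b ∈ T, a < b := by
    intro a
    by_contra! hcon
    exact hTu ⟨a, hcon⟩
  have hseq : ∃ t : ℕ → ℝ, (∀ n, t n ∈ T ∧ (n : ℝ) ≤ t n) ∧ Monotone t := by
    choose nx hnxT hnx using hT
    let t : ℕ → ℝ := fun n => Nat.rec 0 (fun k y => nx (max y (k + 1))) n
    have ht : ∀ n, t (n + 1) = nx (max (t n) (n + 1)) := fun n => rfl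
    refine ⟨t, ?_, monotone_nat_of_le_succ fun n => ?_⟩
    · intro n
      cases n with
      | zero => exact ⟨h0T, by simp [t]⟩
      | succ k =>
        rw [ht]
        refine ⟨hnxT _, ?_⟩
        push_cast
        exact (le_max_right _ _).trans (hnx _).le
    · rw [ht]
      exact (le_max_left _ _).trans (hnx _).le
  obtain ⟨t, htT, htm⟩ := hseq
  have htt : Tendsto t atTop atTop :=
    tendsto_atTop_mono (fun n => (htT n).2) tendsto_natCast_atTop_atTop
  have htt' : Tendsto t atTop (atTop ⊓ 𝓟 T) :=
    tendsto_inf.2 ⟨htt, tendsto_principal.2 (Eventually.of_forall fun n => (htT n).1)⟩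
  have hphi : ∀ x, Tendsto (fun n => phiPt (γ (t n)) x) atTop (𝓝 (h x)) := by
    intro x
    exact ((hunif {x} isCompact_singleton).tendsto_at rfl).comp htt'
  have hb : Tendsto (fun n => ‖γ 0 - γ (t n)‖ - t n) atTop (𝓝 0) := by
    rw [Metric.tendsto_atTop]
    intro ε hε
    obtain ⟨s0, hs0⟩ := hag ε hε
    obtain ⟨N, hN⟩ := (htt.eventually_ge_atTop s0).exists_forall_of_atTop
    refine ⟨N, fun n hn => ?_⟩
    have := hs0 (t n) (htT n).1 (t n) (htT n).1 (hN n hn) le_rfl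
    rw [Real.dist_eq, sub_zero, norm_sub_rev]
    simpa using this
  obtain ⟨E, p, κ, hEn, hEc, hEe, hH⟩ := forward_core (fun x => h x - h (γ 0))
      (fun n => γ (t n)) t (by
        intro ε hε
        obtain ⟨s0, hs0⟩ := hag (ε / 2) (by positivity)
        obtain ⟨N, hN⟩ := (htt.eventually_ge_atTop s0).exists_forall_of_atTop
        refine ⟨N, fun n hn m hm => ?_⟩
        have h1 := hs0 (t n) (htT n).1 (t n) (htT n).1 (hN n hn) le_rfl
        have h2 := hs0 (t n) (htT n).1 (t m) (htT m).1 (hN n hn) (htm hm)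
        rw [sub_self, norm_zero, zero_add, abs_lt] at h1
        rw [abs_lt, norm_sub_rev (γ (t m))] at h2
        linarith) (by
        intro x
        have := ((hphi x).sub (hphi (γ 0))).add hb
        rw [add_zero] at this
        refine this.congr fun n => ?_
        simp only [phiPt]
        ring)
  have h0 : h 0 = 0 := by
    refine tendsto_nhds_unique (hphi 0) ?_
    simp [phiPt]
  have hform : ∀ x : V, h x = suppF E (x - p) - suppF E (-p) := by
    intro x
    have h1 := hH x
    have h2 := hH 0
    simp only [h0, zero_sub] at h1 h2
    linarith
  refine ⟨E, p, hEn, ?_, hEc, hEe, hform⟩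
  rintro rfl
  apply hne p
  funext x
  rw [hform, suppF_ball, suppF_ball, norm_neg, phiPt]

lemma cone_sep {W : Type*} [NormedAddCommGroup W] [NormedSpace ℝ W] [FiniteDimensional ℝ W]
    (C : Set W) (hC : Convex ℝ C) (h0 : (0 : W) ∈ C)
    (hcone : ∀ c ∈ C, ∀ a : ℝ, 0 ≤ a → a • c ∈ C) (u : W) (hu : u ∈ Submodule.span ℝ C)
    (huC : u ∉ C) :
    ∃ f : W →ₗ[ℝ] ℝ, (∀ c ∈ C, f c ≤ 0) ∧ ∃ c ∈ C, f c ≠ 0 := by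
  let S := Submodule.span ℝ C
  let C' : Set S := ((↑) : S → W) ⁻¹' C
  have hC' : Convex ℝ C' := hC.linear_preimage S.subtype
  have h0' : (0 : S) ∈ C' := h0
  have hspan : affineSpan ℝ C' = ⊤ := by
    have h1 := affineSpan_insert_zero (k := ℝ) C'
    rw [Set.insert_eq_of_mem h0'] at h1
    have h2 : Submodule.span ℝ C' = ⊤ := Submodule.span_span_coe_preimage
    rw [h2] at h1
    apply SetLike.coe_injective
    rw [h1]
    simp
  have hint := hC'.interior_nonempty_iff_affineSpan_eq_top.2 hspan
  have huI : (⟨u, hu⟩ : S) ∉ interior C' := fun h => huC (show (⟨u, hu⟩ : S) ∈ C' from interior_subset h)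
  obtain ⟨f, hf⟩ := geometric_hahn_banach_open_point hC'.interior isOpen_interior huI
  have hle : ∀ c ∈ C', f c ≤ f ⟨u, hu⟩ := by
    intro c hc
    have hcl : c ∈ closure (interior C') := by
      rw [hC'.closure_interior_eq_closure_of_nonempty_interior hint]
      exact subset_closure hc
    have : closure (interior C') ⊆ {c | f c ≤ f ⟨u, hu⟩} :=
      closure_minimal (fun a ha => (hf a ha).le) (isClosed_le f.continuous continuous_const)
    exact this hcl
  have hneg : ∀ c ∈ C', f c ≤ 0 := by
    intro c hc
    by_contra! hpos
    have hcc : ((|f ⟨u, hu⟩| + 1) / f c) • c ∈ C' := hcone c hc _ (by positivity)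
    have := hle _ hcc
    rw [map_smul, smul_eq_mul, div_mul_cancel₀ _ hpos.ne'] at this
    linarith [le_abs_self (f ⟨u, hu⟩)]
  have hnz : ∃ c ∈ C', f c ≠ 0 := by
    by_contra! hz
    obtain ⟨a, ha⟩ := hint
    have h1 := hf a ha
    have h2 : ∀ s : S, f s = 0 := by
      intro s
      have hs : s ∈ Submodule.span ℝ C' := by
        have h2 : Submodule.span ℝ C' = ⊤ := Submodule.span_span_coe_preimage
        rw [h2]; trivial
      have hle : Submodule.span ℝ C' ≤ LinearMap.ker (f : S →ₗ[ℝ] ℝ) :=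
        Submodule.span_le.2 fun c hc => by simpa using hz c hc
      simpa using hle hs
    rw [h2, h2] at h1
    exact lt_irrefl _ h1
  obtain ⟨g, hg⟩ := LinearMap.exists_extend (f : S →ₗ[ℝ] ℝ)
  have hgf : ∀ s : S, g s = f s := by
    intro s
    have := congrArg (fun k => k s) hg
    simpa using this
  refine ⟨g, fun c hc => ?_, ?_⟩
  · have := hneg ⟨c, Submodule.subset_span hc⟩ hc
    rw [← hgf] at this
    exact this
  · obtain ⟨c, hc, hcz⟩ := hnz
    exact ⟨c, hc, by rw [hgf]; exact hcz⟩

lemma expose [FiniteDimensional ℝ V] {E G : Set (V →L[ℝ] ℝ)} (hE : Convex ℝ E) (hG : Convex ℝ G)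
    (hne : E.Nonempty) (hex : IsExtreme ℝ G E) (hEG : E ≠ G) :
    ∃ w : V, (∀ g ∈ G, ∀ e ∈ E, g w ≤ e w) ∧ ∃ g ∈ G, ∃ e ∈ E, g w ≠ e w := by
  obtain ⟨g0, hg0, hg0E⟩ : ∃ g ∈ G, g ∉ E := by
    by_contra! hcon
    exact hEG (Set.Subset.antisymm hex.subset hcon)
  obtain ⟨e0, he0⟩ := hne
  let C : Set (V →L[ℝ] ℝ) := {c | ∃ a : ℝ, 0 ≤ a ∧ ∃ g ∈ G, ∃ e ∈ E, c = a • (g - e)}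
  have hcone : ∀ c ∈ C, ∀ a : ℝ, 0 ≤ a → a • c ∈ C := by
    rintro _ ⟨b, hb, g, hg, e, he, rfl⟩ a ha
    exact ⟨a * b, by positivity, g, hg, e, he, by rw [smul_smul]⟩
  have hadd : ∀ c ∈ C, ∀ d ∈ C, c + d ∈ C := by
    rintro _ ⟨a, ha, g, hg, e, he, rfl⟩ _ ⟨b, hb, g', hg', e', he', rfl⟩
    rcases (add_nonneg ha hb).eq_or_lt with h | h
    · have h1 : a = 0 := by linarith
      have h2 : b = 0 := by linarith
      exact ⟨0, le_rfl, g, hg, e, he, by simp [h1, h2]⟩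
    · refine ⟨a + b, h.le, (a / (a + b)) • g + (b / (a + b)) • g',
        hG hg hg' (by positivity) (by positivity) (by field_simp),
        (a / (a + b)) • e + (b / (a + b)) • e',
        hE he he' (by positivity) (by positivity) (by field_simp), ?_⟩
      simp only [smul_sub, smul_add, smul_smul, mul_div_cancel₀ _ h.ne']
      abel
  have hCc : Convex ℝ C := by
    intro c hc d hd a b ha hb _
    exact hadd _ (hcone c hc a ha) _ (hcone d hd b hb)
  have h0 : (0 : V →L[ℝ] ℝ) ∈ C := ⟨0, le_rfl, g0, hg0, e0, he0, by simp⟩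
  have hgC : ∀ g ∈ G, ∀ e ∈ E, g - e ∈ C := fun g hg e he =>
    ⟨1, zero_le_one, g, hg, e, he, by simp⟩
  have hu : e0 - g0 ∈ Submodule.span ℝ C := by
    rw [← neg_sub]
    exact neg_mem (Submodule.subset_span (hgC g0 hg0 e0 he0))
  have huC : e0 - g0 ∉ C := by
    rintro ⟨a, ha, g, hg, e, he, h⟩
    apply hg0E
    rcases ha.eq_or_lt with h1 | h1
    · rw [← h1, zero_smul, sub_eq_zero] at h
      rwa [← h]
    · have hpos : 0 < 1 + a := by linarith
      refine hex.left_mem_of_mem_openSegment hg0 hg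
        (hE he0 he (a := 1 / (1 + a)) (b := a / (1 + a)) (by positivity) (by positivity)
          (by field_simp)) ?_
      refine ⟨1 / (1 + a), a / (1 + a), by positivity, by positivity, by field_simp, ?_⟩
      have h2 : g0 + a • g = e0 + a • e := by
        have : e0 = a • (g - e) + g0 := by rw [← h]; abel
        rw [this, smul_sub]; abel
      have h3 : ∀ x y : V →L[ℝ] ℝ, (1 / (1 + a)) • x + (a / (1 + a)) • y
          = (1 / (1 + a)) • (x + a • y) := by
        intro x y
        rw [smul_add, smul_smul]
        congr 2
        field_simp
      rw [h3, h3, h2]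
  obtain ⟨f, hf, c, ⟨a, ha, g, hg, e, he, rfl⟩, hfc⟩ := cone_sep C hCc h0 hcone _ hu huC
  obtain ⟨w, hw⟩ := bidual_rep f
  refine ⟨w, fun g hg e he => ?_, g, hg, e, he, ?_⟩
  · have := hf _ (hgC g hg e he)
    rw [hw] at this
    simpa using this
  · intro h
    apply hfc
    rw [hw]
    simp [h]

/-- The approximation property of a set of functionals. -/
def ApproxProp (E : Set (V →L[ℝ] ℝ)) : Prop :=
  ∀ R ε : ℝ, 0 < R → 0 < ε → ∃ (w : V) (c : ℝ), (∀ q ∈ E, q w = c) ∧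
    ∀ x : V, ‖x‖ ≤ R → ‖x + w‖ ≤ suppF E x + c + ε

lemma approx_step {G F : Set (V →L[ℝ] ℝ)} (hGc : IsCompact G) (hGB : G ⊆ Metric.closedBall 0 1)
    (hP : ApproxProp G) (w1 : V) (m : ℝ) (hm : ∀ q ∈ G, q w1 ≤ m)
    (hF : F = {q | q ∈ G ∧ q w1 = m}) (hFne : F.Nonempty) : ApproxProp F := by
  intro R ε hR hε
  have hFG : F ⊆ G := by rw [hF]; exact fun q hq => hq.1
  have hFB := hFG.trans hGB
  have hcont : Continuous fun q : V →L[ℝ] ℝ => q w1 :=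
    (ContinuousLinearMap.apply ℝ ℝ w1).continuous
  set η : ℝ := ε / 2 / R with hη
  have hηpos : 0 < η := by positivity
  let K : Set (V →L[ℝ] ℝ) := G ∩ {q | η ≤ Metric.infDist q F}
  have hK : IsCompact K :=
    hGc.inter_right (isClosed_le continuous_const (Metric.continuous_infDist_pt F))
  have hδ : ∃ δ > 0, ∀ q ∈ K, q w1 ≤ m - δ := by
    rcases K.eq_empty_or_nonempty with h | h
    · exact ⟨1, one_pos, by simp [h]⟩
    · obtain ⟨q0, hq0, hmax⟩ := hK.exists_isMaxOn h hcont.continuousOn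
      refine ⟨m - q0 w1, ?_, fun q hq => ?_⟩
      · have h1 := hm q0 hq0.1
        rcases h1.eq_or_lt with h2 | h2
        · exfalso
          have h3 : q0 ∈ F := by rw [hF]; exact ⟨hq0.1, h2⟩
          have h4 : η ≤ Metric.infDist q0 F := hq0.2
          rw [Metric.infDist_zero_of_mem h3] at h4
          linarith
        · linarith
      · have : q w1 ≤ q0 w1 := hmax hq
        linarith
  obtain ⟨δ, hδpos, hδ⟩ := hδ
  set a : ℝ := 2 * R / δ with ha
  have hapos : 0 < a := by positivity
  have hGF : ∀ x : V, ‖x‖ ≤ R → suppF G (x + a • w1) ≤ suppF F x + a * m + ε / 2 := by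
    intro x hx
    refine suppF_le (hFne.mono hFG) _ fun q hq => ?_
    rw [map_add, map_smul, smul_eq_mul]
    by_cases hqK : η ≤ Metric.infDist q F
    · have h1 := hδ q ⟨hq, hqK⟩
      have h2 := ball_apply_le (hGB hq) x
      obtain ⟨q', hq'⟩ := hFne
      have h3 := ball_neg_le_apply (hFB hq') x
      have h4 := le_suppF hFB x hq'
      have h5 : a * q w1 ≤ a * (m - δ) := by gcongr
      have h6 : a * δ = 2 * R := by rw [ha]; field_simp
      nlinarith
    · rw [not_le, Metric.infDist_lt_iff hFne] at hqK
      obtain ⟨q', hq', hd⟩ := hqK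
      have h4 := le_suppF hFB x hq'
      have h5 : a * q w1 ≤ a * m := by gcongr; exact hm q hq
      have h6 : q x - q' x ≤ ε / 2 := by
        calc q x - q' x = (q - q') x := by simp
          _ ≤ ‖(q - q') x‖ := Real.le_norm_self _
          _ ≤ ‖q - q'‖ * ‖x‖ := (q - q').le_opNorm x
          _ ≤ η * R := by
            rw [dist_eq_norm] at hd
            gcongr
          _ = ε / 2 := by rw [hη]; field_simp
      linarith
  obtain ⟨w2, c2, hc2, hw2⟩ := hP (R + ‖a • w1‖) (ε / 2) (by positivity) (by positivity)
  refine ⟨a • w1 + w2, a * m + c2, fun q hq => ?_, fun x hx => ?_⟩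
  · have h1 : q w1 = m := by rw [hF] at hq; exact hq.2
    rw [map_add, map_smul, h1, hc2 q (hFG hq), smul_eq_mul]
  · have h1 := hw2 (x + a • w1) ((norm_add_le _ _).trans (by gcongr))
    have h2 := hGF x hx
    rw [← add_assoc]
    linarith

lemma approx_of_chain [FiniteDimensional ℝ V] {E : Set (V →L[ℝ] ℝ)} (hE : Convex ℝ E)
    (hne : E.Nonempty) (hex : IsExtreme ℝ (Metric.closedBall (0 : V →L[ℝ] ℝ) 1) E) :
    ∀ (n : ℕ) (G : Set (V →L[ℝ] ℝ)), Module.finrank ℝ (vectorSpan ℝ G) ≤ n → IsCompact G →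
      Convex ℝ G → G ⊆ Metric.closedBall 0 1 → E ⊆ G → ApproxProp G →
      IsCompact E ∧ ApproxProp E := by
  intro n
  induction n with
  | zero =>
    intro G hn hGc hG hGB hEG hP
    have : E = G := by
      by_contra hEG'
      obtain ⟨w, -, g, hg, e, he, hge⟩ := expose hE hG hne (hex.mono hGB hEG) hEG'
      have h1 : vectorSpan ℝ G = ⊥ := by
        apply Submodule.finrank_eq_zero.1; omega
      have h2 : g -ᵥ e ∈ vectorSpan ℝ G := vsub_mem_vectorSpan ℝ hg (hEG he)
      rw [h1, Submodule.mem_bot, vsub_eq_zero_iff_eq] at h2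
      exact hge (by rw [h2])
    rw [this]
    exact ⟨hGc, hP⟩
  | succ n ih =>
    intro G hn hGc hG hGB hEG hP
    by_cases hEG' : E = G
    · rw [hEG']
      exact ⟨hGc, hP⟩
    obtain ⟨w, hw, g, hg, e, he, hge⟩ := expose hE hG hne (hex.mono hGB hEG) hEG'
    let F : Set (V →L[ℝ] ℝ) := {q | q ∈ G ∧ q w = e w}
    have hEF : E ⊆ F := fun q hq =>
      ⟨hEG hq, le_antisymm (hw q (hEG hq) e he) (hw e (hEG he) q hq)⟩
    have hFG : F ⊆ G := fun q hq => hq.1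
    have hcont : Continuous fun q : V →L[ℝ] ℝ => q w :=
      (ContinuousLinearMap.apply ℝ ℝ w).continuous
    refine ih F ?_ (hGc.inter_right (isClosed_eq hcont continuous_const)) ?_ (hFG.trans hGB) hEF
      (approx_step hGc hGB hP w (e w) (fun q hq => hw q hq e he) rfl (hne.mono hEF))
    · have hlt : vectorSpan ℝ F < vectorSpan ℝ G := by
        refine lt_of_le_of_ne (vectorSpan_mono ℝ hFG) fun heq => ?_
        have h2 : g -ᵥ e ∈ vectorSpan ℝ G := vsub_mem_vectorSpan ℝ hg (hEG he)
        rw [← heq, vectorSpan_def] at h2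
        have h3 : Submodule.span ℝ (F -ᵥ F) ≤
            LinearMap.ker (ContinuousLinearMap.apply ℝ ℝ w : (V →L[ℝ] ℝ) →ₗ[ℝ] ℝ) := by
          refine Submodule.span_le.2 ?_
          rintro _ ⟨q, hq, q', hq', rfl⟩
          simp [hq.2, hq'.2]
        have h4 := h3 h2
        simp [sub_eq_zero] at h4
        exact hge h4
      have := Submodule.finrank_lt_finrank_of_lt hlt
      omega
    · rintro q1 ⟨h1, h1'⟩ q2 ⟨h2, h2'⟩ a b ha hb hab
      refine ⟨hG h1 h2 ha hb hab, ?_⟩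
      simp only [add_apply, smul_apply, h1', h2',
        smul_eq_mul]
      rw [← add_mul, hab, one_mul]

lemma approx_extreme [FiniteDimensional ℝ V] {E : Set (V →L[ℝ] ℝ)} (hE : Convex ℝ E)
    (hne : E.Nonempty) (hex : IsExtreme ℝ (Metric.closedBall (0 : V →L[ℝ] ℝ) 1) E) :
    IsCompact E ∧ ApproxProp E := by
  refine approx_of_chain hE hne hex _ _ le_rfl (isCompact_closedBall _ _) (convex_closedBall _ _)
    subset_rfl hex.subset ?_
  intro R ε hR hε
  refine ⟨0, 0, by simp, fun x _ => ?_⟩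
  rw [suppF_ball]
  simp [hε.le]

lemma exists_neg_dir [FiniteDimensional ℝ V] {E : Set (V →L[ℝ] ℝ)} (hE : Convex ℝ E)
    (hc : IsCompact E) (hex : IsExtreme ℝ (Metric.closedBall (0 : V →L[ℝ] ℝ) 1) E)
    (hEB : E ≠ Metric.closedBall 0 1) : ∃ v : V, ∀ q ∈ E, q v ≤ -1 := by
  have h0 : (0 : V →L[ℝ] ℝ) ∉ E := by
    intro h0
    apply hEB
    refine hex.subset.antisymm fun q hq => ?_
    refine hex.left_mem_of_mem_openSegment hq (y := -q) (by simpa using hq) h0 ?_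
    exact ⟨1 / 2, 1 / 2, by norm_num, by norm_num, by norm_num, by simp⟩
  obtain ⟨f, u, hf0, hf⟩ := geometric_hahn_banach_point_closed hE hc.isClosed h0
  obtain ⟨v, hv⟩ := bidual_rep (f : (V →L[ℝ] ℝ) →ₗ[ℝ] ℝ)
  rw [map_zero] at hf0
  refine ⟨-(u⁻¹ • v), fun q hq => ?_⟩
  have h1 := hf q hq
  have h2 : f q = q v := hv q
  rw [h2] at h1
  rw [map_neg, map_smul, smul_eq_mul, neg_le_neg_iff, inv_mul_eq_div, le_div_iff₀ hf0]
  linarith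

lemma backward [FiniteDimensional ℝ V] (h : V → ℝ) (E : Set (V →L[ℝ] ℝ)) (p : V)
    (hne : E.Nonempty) (hEB : E ≠ Metric.closedBall 0 1) (hE : Convex ℝ E)
    (hex : IsExtreme ℝ (Metric.closedBall 0 1) E)
    (hh : ∀ x : V, h x = suppF E (x - p) - suppF E (-p)) : IsBusemannPoint V h := by
  obtain ⟨hc, hP⟩ := approx_extreme hE hne hex
  obtain ⟨v, hv⟩ := exists_neg_dir hE hc hex hEB
  have hB := hex.subset
  have hW : ∀ n : ℕ, ∃ (w : V) (c : ℝ), (∀ q ∈ E, q w = c) ∧ (n : ℝ) + 1 ≤ c ∧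
      ∀ x : V, ‖x‖ ≤ n → ‖x + w‖ ≤ suppF E x + c + 1 / ((n : ℝ) + 1) := by
    intro n
    obtain ⟨w, c, h1, h2⟩ := hP (n + (n + 2) * ‖v‖ + 1) (1 / ((n : ℝ) + 1)) (by positivity)
      (by positivity)
    refine ⟨w, c, h1, ?_, fun x hx => h2 x (hx.trans ?_)⟩
    · have h3 := h2 (((n : ℝ) + 2) • v) (by
        rw [norm_smul, Real.norm_of_nonneg (by positivity)]
        linarith [(Nat.cast_nonneg n : (0:ℝ) ≤ n)])
      have h4 : suppF E (((n : ℝ) + 2) • v) ≤ -(n + 2) := by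
        refine suppF_le hne _ fun q hq => ?_
        rw [map_smul, smul_eq_mul]
        nlinarith [hv q hq, (Nat.cast_nonneg n : (0:ℝ) ≤ n)]
      have h5 : 1 / ((n : ℝ) + 1) ≤ 1 := by
        rw [div_le_one (by positivity)]
        linarith [(Nat.cast_nonneg n : (0:ℝ) ≤ n)]
      linarith [norm_nonneg (((n : ℝ) + 2) • v + w)]
    · nlinarith [norm_nonneg v, (Nat.cast_nonneg n : (0:ℝ) ≤ n)]
  choose W C hWC hCn hWx using hW
  have hlow : ∀ n x, suppF E x + C n ≤ ‖x + W n‖ := by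
    intro n x
    have : suppF E x ≤ ‖x + W n‖ - C n := by
      refine suppF_le hne _ fun q hq => ?_
      have := ball_apply_le (hB hq) (x + W n)
      rw [map_add, hWC n q hq] at this
      linarith
    linarith
  have habs : ∀ (n : ℕ) (x : V), ‖x‖ ≤ n → |‖x + W n‖ - (suppF E x + C n)| ≤ 1 / ((n : ℝ) + 1) := by
    intro n x hx
    rw [abs_of_nonneg (by linarith [hlow n x])]
    linarith [hWx n x hx]
  have hz : Tendsto (fun n : ℕ => 1 / ((n : ℝ) + 1)) atTop (𝓝 0) :=
    tendsto_one_div_add_atTop_nhds_zero_nat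
  have hunif : ∀ K : Set V, IsCompact K →
      TendstoUniformlyOn (fun n x => phiPt (p - W n) x) h atTop K := by
    intro K hK
    obtain ⟨R, hR⟩ := hK.isBounded.exists_norm_le
    rw [Metric.tendstoUniformlyOn_iff]
    intro ε hε
    filter_upwards [hz.eventually_lt_const (show 0 < ε / 2 by positivity),
      tendsto_natCast_atTop_atTop.eventually_ge_atTop (|R| + ‖p‖)] with n hn1 hn2 x hx
    have h1 := habs n (x - p) (by
      calc ‖x - p‖ ≤ ‖x‖ + ‖p‖ := norm_sub_le _ _
        _ ≤ |R| + ‖p‖ := by gcongr; exact (hR x hx).trans (le_abs_self R)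
        _ ≤ n := hn2)
    have h2 := habs n (-p) (by rw [norm_neg]; linarith [abs_nonneg R])
    have e1 : x - p + W n = x - (p - W n) := by abel
    have e2 : ‖-p + W n‖ = ‖p - W n‖ := by rw [← norm_neg]; congr 1; abel
    rw [e1] at h1
    rw [e2] at h2
    rw [Real.dist_eq, hh, phiPt]
    rw [abs_le] at h1 h2
    rw [abs_lt]
    constructor <;> linarith
  refine ⟨⟨⟨fun n => p - W n, hunif⟩, ?_⟩, ?_⟩
  · intro z hz
    set a : ℝ := ‖z‖ + ‖p‖ + |suppF E (-p)| + 1 with ha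
    have h1 := congrFun hz (a • v)
    rw [hh, phiPt] at h1
    have h2 : suppF E (a • v - p) ≤ -a + ‖p‖ := by
      refine suppF_le hne _ fun q hq => ?_
      have h3 := ball_neg_le_apply (hB hq) p
      have h4 : a * q v ≤ a * (-1) := by
        have : 0 ≤ a := by positivity
        gcongr
        exact hv q hq
      rw [map_sub, map_smul, smul_eq_mul]
      linarith
    linarith [norm_nonneg (a • v - z), neg_abs_le (suppF E (-p))]
  · obtain ⟨f, -, hf⟩ := exists_seq_of_forall_finset_exists (fun _ : ℕ => True)
      (fun k l => k < l ∧ ‖W k‖ ≤ l ∧ C k < C l) (by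
        intro s _
        obtain ⟨l, hl⟩ := exists_nat_gt (∑ k ∈ s, ((k : ℝ) + ‖W k‖ + |C k|))
        refine ⟨l, trivial, fun k hk => ?_⟩
        have h1 : (k : ℝ) + ‖W k‖ + |C k| ≤ ∑ k ∈ s, ((k : ℝ) + ‖W k‖ + |C k|) :=
          Finset.single_le_sum (f := fun k : ℕ => (k : ℝ) + ‖W k‖ + |C k|)
            (fun i _ => by positivity) hk
        have h2 := norm_nonneg (W k)
        have h3 := abs_nonneg (C k)
        have h4 := le_abs_self (C k)
        have h5 : (0 : ℝ) ≤ k := Nat.cast_nonneg k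
        have h6 := hCn l
        refine ⟨?_, by linarith, by linarith⟩
        have : (k : ℝ) < l := by linarith
        exact_mod_cast this)
    have hfm : StrictMono f := fun m n hmn => (hf m n hmn).1
    have hcm : StrictMono (fun n => C (f n)) := fun m n hmn => (hf m n hmn).2.2
    set T : Set ℝ := insert 0 (Set.range fun n => C (f n)) with hT
    set γ : ℝ → V := Function.extend (fun n => C (f n)) (fun n => p - W (f n)) (fun _ => p) with hγ
    have hγC : ∀ n, γ (C (f n)) = p - W (f n) := fun n => hcm.injective.extend_apply _ _ n
    have hCpos : ∀ n, 0 < C n := fun n => by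
      linarith [hCn n, (Nat.cast_nonneg n : (0:ℝ) ≤ n)]
    have hγ0 : γ 0 = p := by
      refine Function.extend_apply' _ _ _ ?_
      rintro ⟨n, hn⟩
      exact (hCpos (f n)).ne' hn
    have hCf : ∀ n : ℕ, (n : ℝ) ≤ C (f n) := by
      intro n
      have h1 : (n : ℝ) ≤ f n := by exact_mod_cast hfm.id_le n
      linarith [hCn (f n)]
    -- large elements of `T` come from large indices
    have hlarge : ∀ N : ℕ, ∀ s ∈ T, C (f N) ≤ s → ∃ n ≥ N, s = C (f n) := by
      rintro N s (rfl | ⟨n, rfl⟩) hs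
      · exact absurd hs (not_le.2 (hCpos _))
      · exact ⟨n, hcm.le_iff_le.1 hs, rfl⟩
    refine ⟨T, γ, ⟨?_, Set.mem_insert _ _, ?_, ?_⟩, ?_⟩
    · rintro s (rfl | ⟨n, rfl⟩)
      · simp
      · exact (hCpos _).le
    · rintro ⟨M, hM⟩
      obtain ⟨n, hn⟩ := exists_nat_gt M
      have := hM (Set.mem_insert_of_mem _ ⟨n, rfl⟩ : C (f n) ∈ T)
      linarith [hCf n]
    · intro ε hε
      obtain ⟨N, hN⟩ := (hz.eventually_lt_const
        (show 0 < ε / 2 by positivity)).exists_forall_of_atTop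
      have hs0 : suppF E 0 = 0 := by
        apply le_antisymm
        · exact suppF_le hne _ (by simp)
        · obtain ⟨q, hq⟩ := hne
          simpa using le_suppF hB 0 hq
      have hone : ∀ n, |‖W n‖ - C n| ≤ 1 / ((n : ℝ) + 1) := by
        intro n
        have := habs n 0 (by simp)
        simpa [hs0] using this
      refine ⟨C (f N), ?_⟩
      intro s hs t ht hs0' hst
      obtain ⟨m, hm, rfl⟩ := hlarge N s hs hs0'
      obtain ⟨n, hn, rfl⟩ := hlarge N t ht (hs0'.trans hst)
      have hmn : m ≤ n := hcm.le_iff_le.1 hst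
      have h1 := hone (f m)
      have h1' := hN (f m) (hm.trans (hfm.id_le m))
      rw [hγC, hγC, hγ0]
      have e1 : ‖p - W (f m) - p‖ = ‖W (f m)‖ := by
        rw [← norm_neg]; congr 1; abel
      rw [e1]
      rcases hmn.eq_or_lt with rfl | hlt
      · simp only [sub_self, norm_zero, zero_add]
        linarith
      · have h2 := habs (f n) (-W (f m)) (by rw [norm_neg]; exact (hf m n hlt).2.1)
        have h2' := hN (f n) (hn.trans (hfm.id_le n))
        have hsm : suppF E (-W (f m)) = - C (f m) := by
          apply le_antisymm
          · exact suppF_le hne _ fun q hq => by rw [map_neg, hWC _ q hq]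
          · obtain ⟨q, hq⟩ := hne
            have := le_suppF hB (-W (f m)) hq
            rwa [map_neg, hWC _ q hq] at this
        have e2 : ‖p - W (f n) - (p - W (f m))‖ = ‖-W (f m) + W (f n)‖ := by
          rw [← norm_neg]; congr 1; abel
        rw [e2]
        rw [hsm] at h2
        rw [abs_le] at h1 h2
        rw [abs_lt]
        constructor <;> linarith
    · intro K hK
      have hu := hunif K hK
      rw [Metric.tendstoUniformlyOn_iff] at hu ⊢
      intro ε hε
      obtain ⟨N, hN⟩ := (hu ε hε).exists_forall_of_atTop
      rw [eventually_inf_principal]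
      filter_upwards [eventually_ge_atTop (C (f N))] with t ht htT x hx
      obtain ⟨n, hn, rfl⟩ := hlarge N t htT ht
      rw [hγC]
      exact hN (f n) (hn.trans (hfm.id_le n)) x hx

end aux

/-- Busemann points of a finite-dimensional normed space: `h` is a Busemann point iff
there are a proper extreme set `E` of the dual unit ball and a point `p ∈ V` with
`h(x) = sup_{q ∈ E} q(x - p) + inf_{y ∈ E} y(p)` for all `x`. -/
theorem busemann_points_of_normed_space (V : Type*) [NormedAddCommGroup V]
    [NormedSpace ℝ V] [FiniteDimensional ℝ V] (h : V → ℝ) :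
    IsBusemannPoint V h ↔
      ∃ (E : Set (V →L[ℝ] ℝ)) (p : V),
        E.Nonempty ∧ E ≠ Metric.closedBall 0 1 ∧ Convex ℝ E ∧
        IsExtreme ℝ (Metric.closedBall 0 1) E ∧
        ∀ x : V,
          h x = sSup ((fun q : V →L[ℝ] ℝ => q (x - p)) '' E) +
            sInf ((fun y : V →L[ℝ] ℝ => y p) '' E) := by
  constructor
  · intro hB
    obtain ⟨E, p, h1, h2, h3, h4, h5⟩ := forward h hB
    refine ⟨E, p, h1, h2, h3, h4, fun x => ?_⟩
    rw [suppF_neg, ← sub_eq_add_neg]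
    exact h5 x
  · rintro ⟨E, p, h1, h2, h3, h4, h5⟩
    refine backward h E p h1 h2 h3 h4 fun x => ?_
    rw [h5 x, suppF_neg, ← sub_eq_add_neg]
    rfl
end

section
/- Convergence to the horofunction boundary of a Hilbert geometry implies Euclidean convergence to the boundary: Let N ≥ 1 and let D ⊆ ℝᴺ be a nonempty bounded open convex set, equipped with the Hilbert metric d_H and a basepoint b ∈ D; set φ_z(x) = d_H(x,z) − d_H(b,z) for x, z ∈ D. If (zₙ) is a sequence in D such that φ_{zₙ} converges uniformly on compact subsets of D to a function h : D → ℝ with h ≠ φ_z for every z ∈ D (i.e. the sequence converges to a point of the horofunction boundary), then (zₙ) converges in the usual topology of ℝᴺ to a point of the Euclidean boundary ∂D of D. -/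
open Filter Topology
open scoped Classical

/-- The Hilbert distance on a bounded open convex set `D ⊆ ℝᴺ`: for `x ≠ y`, with
`z = x + t* (y - x)`, `t* = sup {t ≥ 0 : x + t(y-x) ∈ D}`, and
`w = x + s* (y - x)`, `s* = inf {t ≤ 0 : x + t(y-x) ∈ D}`, the distance is
`log ((|z-x|·|w-y|) / (|z-y|·|w-x|))`; and `d_H(x,x) = 0`. -/
noncomputable def hilbertDist {N : ℕ} (D : Set (EuclideanSpace ℝ (Fin N)))
    (x y : EuclideanSpace ℝ (Fin N)) : ℝ :=
  if x = y then 0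
  else
    let tstar := sSup {t : ℝ | 0 ≤ t ∧ x + t • (y - x) ∈ D}
    let sstar := sInf {t : ℝ | t ≤ 0 ∧ x + t • (y - x) ∈ D}
    let z := x + tstar • (y - x)
    let w := x + sstar • (y - x)
    Real.log ((‖z - x‖ * ‖w - y‖) / (‖z - y‖ * ‖w - x‖))

namespace HilbHoro

/-- Value of the affine functional `f = (l, c)` at `x`. -/
noncomputable def ev {N : ℕ} (f : (EuclideanSpace ℝ (Fin N) →L[ℝ] ℝ) × ℝ)
    (x : EuclideanSpace ℝ (Fin N)) : ℝ := f.1 x + f.2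

/-- Affine functionals positive on `D`. -/
def PA {N : ℕ} (D : Set (EuclideanSpace ℝ (Fin N))) :
    Set ((EuclideanSpace ℝ (Fin N) →L[ℝ] ℝ) × ℝ) := {f | ∀ x ∈ D, 0 < ev f x}

/-- `M x y = sup_f f x / f y`. -/
noncomputable def M {N : ℕ} (D : Set (EuclideanSpace ℝ (Fin N)))
    (x y : EuclideanSpace ℝ (Fin N)) : ℝ :=
  sSup ((fun f => ev f x / ev f y) '' PA D)

section
variable {N : ℕ} {D : Set (EuclideanSpace ℝ (Fin N))}

lemma one_mem : ((0 : EuclideanSpace ℝ (Fin N) →L[ℝ] ℝ), (1 : ℝ)) ∈ PA D := by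
  intro x _; simp [ev]

lemma ev_comb (f : (EuclideanSpace ℝ (Fin N) →L[ℝ] ℝ) × ℝ) (x y : EuclideanSpace ℝ (Fin N))
    (t : ℝ) : ev f (x + t • (y - x)) = (1 - t) * ev f x + t * ev f y := by
  simp [ev]; ring

lemma ev_cont (f : (EuclideanSpace ℝ (Fin N) →L[ℝ] ℝ) × ℝ) : Continuous (ev f) := by
  unfold ev; fun_prop

lemma ev_nonneg {f : (EuclideanSpace ℝ (Fin N) →L[ℝ] ℝ) × ℝ} (hf : f ∈ PA D)
    {x : EuclideanSpace ℝ (Fin N)} (hx : x ∈ closure D) : 0 ≤ ev f x := by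
  have : closure D ⊆ {x | 0 ≤ ev f x} :=
    closure_minimal (fun y hy => (hf y hy).le) (isClosed_le continuous_const (ev_cont f))
  exact this hx

lemma lip (hopen : IsOpen D) {b : EuclideanSpace ℝ (Fin N)} (hb : b ∈ D) :
    ∃ L : ℝ, 0 < L ∧ ∀ f ∈ PA D, ∀ u v, ev f u - ev f v ≤ L * ‖u - v‖ * ev f b := by
  obtain ⟨r, hr, hball⟩ := Metric.isOpen_iff.1 hopen b hb
  refine ⟨2 / r, by positivity, fun f hf u v => ?_⟩
  have key : ev f u - ev f v = f.1 (u - v) := by simp [ev]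
  by_cases huv : u - v = 0
  · rw [key, huv]; simp
  have hn : 0 < ‖u - v‖ := norm_pos_iff.2 huv
  have hm : b - (r / (2 * ‖u - v‖)) • (u - v) ∈ D := by
    apply hball
    rw [Metric.mem_ball, dist_eq_norm]
    simp only [sub_sub_cancel_left, norm_neg, norm_smul, Real.norm_eq_abs]
    rw [abs_of_pos (by positivity)]
    have : r / (2 * ‖u - v‖) * ‖u - v‖ = r / 2 := by field_simp
    rw [this]; linarith
  have h1 := hf _ hm
  have h2 : ev f (b - (r / (2 * ‖u - v‖)) • (u - v))
      = ev f b - r / (2 * ‖u - v‖) * f.1 (u - v) := by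
    simp [ev]; ring
  rw [h2] at h1
  rw [key]
  have h3 : r / (2 * ‖u - v‖) * f.1 (u - v) < ev f b := by linarith
  have h4 : f.1 (u - v) = (2 / r * ‖u - v‖) * (r / (2 * ‖u - v‖) * f.1 (u - v)) := by
    field_simp
  rw [h4]
  exact mul_le_mul_of_nonneg_left h3.le (by positivity)

lemma bdd (hopen : IsOpen D) {y : EuclideanSpace ℝ (Fin N)} (hy : y ∈ D)
    (x : EuclideanSpace ℝ (Fin N)) : BddAbove ((fun f => ev f x / ev f y) '' PA D) := by
  obtain ⟨L, hL, h⟩ := lip hopen hy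
  refine ⟨1 + L * ‖x - y‖, ?_⟩
  rintro _ ⟨f, hf, rfl⟩
  have := h f hf x y
  have h0 := hf y hy
  simp only
  rw [div_le_iff₀ h0]; linarith

lemma le_M (hopen : IsOpen D) {y : EuclideanSpace ℝ (Fin N)} (hy : y ∈ D)
    (x : EuclideanSpace ℝ (Fin N)) {f : (EuclideanSpace ℝ (Fin N) →L[ℝ] ℝ) × ℝ}
    (hf : f ∈ PA D) : ev f x / ev f y ≤ M D x y :=
  le_csSup (bdd hopen hy x) ⟨f, hf, rfl⟩

lemma le_M' (hopen : IsOpen D) {y : EuclideanSpace ℝ (Fin N)} (hy : y ∈ D)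
    (x : EuclideanSpace ℝ (Fin N)) {f : (EuclideanSpace ℝ (Fin N) →L[ℝ] ℝ) × ℝ}
    (hf : f ∈ PA D) : ev f x ≤ M D x y * ev f y := by
  have := le_M hopen hy x hf
  rwa [div_le_iff₀ (hf y hy)] at this

lemma M_le {x y : EuclideanSpace ℝ (Fin N)} (hy : y ∈ D) {c : ℝ}
    (h : ∀ f ∈ PA D, ev f x ≤ c * ev f y) : M D x y ≤ c := by
  apply csSup_le (Set.Nonempty.image _ ⟨_, one_mem⟩)
  rintro _ ⟨f, hf, rfl⟩
  simp only
  rw [div_le_iff₀ (hf y hy)]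
  exact h f hf

lemma one_le_M (hopen : IsOpen D) {y : EuclideanSpace ℝ (Fin N)} (hy : y ∈ D)
    (x : EuclideanSpace ℝ (Fin N)) : 1 ≤ M D x y := by
  have := le_M hopen hy x one_mem
  simpa [ev] using this

lemma M_self (hopen : IsOpen D) {y : EuclideanSpace ℝ (Fin N)} (hy : y ∈ D) : M D y y = 1 :=
  le_antisymm (M_le hy fun f _ => by simp) (one_le_M hopen hy y)

lemma M_trans (hopen : IsOpen D) {y z : EuclideanSpace ℝ (Fin N)} (hy : y ∈ D) (hz : z ∈ D)
    (x : EuclideanSpace ℝ (Fin N)) : M D x z ≤ M D x y * M D y z := by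
  apply M_le hz
  intro f hf
  have h1 := le_M' hopen hy x hf
  have h2 := le_M' hopen hz y hf
  have h3 := one_le_M hopen hy x
  calc _ ≤ _ := h1
    _ ≤ M D x y * (M D y z * ev f z) := by gcongr
    _ = _ := by ring

lemma M_cont (hopen : IsOpen D) {y : EuclideanSpace ℝ (Fin N)} (hy : y ∈ D) :
    Continuous (fun x => M D x y) := by
  obtain ⟨L, hL, h⟩ := lip hopen hy
  have : LipschitzWith (Real.toNNReal L) (fun x => M D x y) := by
    apply LipschitzWith.of_le_add_mul
    intro u v
    rw [Real.coe_toNNReal _ hL.le, dist_eq_norm]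
    apply M_le hy
    intro f hf
    have h1 := h f hf u v
    have h2 := le_M' hopen hy v hf
    linarith
  exact this.continuous

lemma support (hopen : IsOpen D) (hconvex : Convex ℝ D) {e : EuclideanSpace ℝ (Fin N)}
    (he : e ∉ D) : ∃ f ∈ PA D, ev f e = 0 := by
  obtain ⟨l, hl⟩ := geometric_hahn_banach_open_point hconvex hopen he
  refine ⟨(-l, l e), fun x hx => ?_, by simp [ev]⟩
  have := hl x hx
  simp [ev]; linarith

lemma M_eq (hopen : IsOpen D) (hconvex : Convex ℝ D) {x y e : EuclideanSpace ℝ (Fin N)}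
    (hy : y ∈ D) (he : e ∈ closure D) (he' : e ∉ D) {τ : ℝ}
    (hτ : 1 < τ) (hxy : e = x + τ • (y - x)) : M D x y = τ / (τ - 1) := by
  have h0 : 0 < τ - 1 := by linarith
  apply le_antisymm
  · apply M_le hy
    intro f hf
    have h1 := ev_nonneg hf he
    rw [hxy, ev_comb] at h1
    rw [div_mul_eq_mul_div, le_div_iff₀ h0]
    linarith
  · obtain ⟨f, hf, hfe⟩ := support hopen hconvex he'
    have h1 := le_M' hopen hy x hf
    have h2 := hf y hy
    rw [hxy, ev_comb] at hfe
    rw [div_le_iff₀ h0]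
    have : τ * ev f y ≤ (M D x y * (τ - 1)) * ev f y := by nlinarith
    exact le_of_mul_le_mul_right this h2

lemma ray (hopen : IsOpen D) (hbdd : Bornology.IsBounded D) {x v : EuclideanSpace ℝ (Fin N)}
    (hx : x ∈ D) (hv : v ≠ 0) :
    (∀ t, 0 ≤ t → x + t • v ∈ D → t < sSup {t : ℝ | 0 ≤ t ∧ x + t • v ∈ D}) ∧
    x + sSup {t : ℝ | 0 ≤ t ∧ x + t • v ∈ D} • v ∈ closure D ∧
    x + sSup {t : ℝ | 0 ≤ t ∧ x + t • v ∈ D} • v ∉ D := by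
  set T := {t : ℝ | 0 ≤ t ∧ x + t • v ∈ D} with hT
  have hn : 0 < ‖v‖ := norm_pos_iff.2 hv
  have hne : T.Nonempty := ⟨0, le_rfl, by simpa using hx⟩
  have hbd : BddAbove T := by
    obtain ⟨R, hR⟩ := hbdd.exists_norm_le
    refine ⟨(R + ‖x‖) / ‖v‖, ?_⟩
    rintro t ⟨ht, htD⟩
    have h1 := hR _ htD
    rw [le_div_iff₀ hn]
    have h2 : ‖t • v‖ ≤ ‖x + t • v‖ + ‖x‖ := by
      have := norm_sub_le (x + t • v) x
      simpa using this
    rw [norm_smul, Real.norm_eq_abs, abs_of_nonneg ht] at h2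
    linarith
  have hcont : Continuous (fun t : ℝ => x + t • v) := by fun_prop
  have hcl : x + sSup T • v ∈ closure D := by
    have h1 : sSup T ∈ closure T := csSup_mem_closure hne hbd
    exact map_mem_closure (f := fun t : ℝ => x + t • v) hcont h1 (fun t ht => ht.2)
  have h0 : 0 ≤ sSup T := le_csSup hbd ⟨le_rfl, by simpa using hx⟩
  have hnot : x + sSup T • v ∉ D := by
    intro hmem
    have hop : IsOpen ((fun t : ℝ => x + t • v) ⁻¹' D) := hopen.preimage hcont
    obtain ⟨r, hr, hb⟩ := Metric.isOpen_iff.1 hop (sSup T) hmem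
    have : sSup T + r / 2 ∈ T := by
      refine ⟨by linarith, ?_⟩
      apply hb
      rw [Metric.mem_ball, Real.dist_eq, add_sub_cancel_left, abs_of_pos (by linarith)]
      linarith
    have := le_csSup hbd this
    linarith
  refine ⟨fun t ht htD => lt_of_le_of_ne (le_csSup hbd ⟨ht, htD⟩) ?_, hcl, hnot⟩
  intro h
  apply hnot
  rw [← h]; exact htD

lemma dist_eq_log (hopen : IsOpen D) (hbdd : Bornology.IsBounded D) (hconvex : Convex ℝ D)
    {x y : EuclideanSpace ℝ (Fin N)} (hx : x ∈ D) (hy : y ∈ D) :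
    hilbertDist D x y = Real.log (M D x y) + Real.log (M D y x) := by
  by_cases hxy : x = y
  · subst hxy
    simp [hilbertDist, M_self hopen hx]
  have hv : y - x ≠ 0 := sub_ne_zero.2 (Ne.symm hxy)
  have hn : 0 < ‖y - x‖ := norm_pos_iff.2 hv
  obtain ⟨h1, h2, h3⟩ := ray hopen hbdd hx hv
  obtain ⟨k1, k2, k3⟩ := ray hopen hbdd hx (neg_ne_zero.2 hv)
  have hs : sInf {t : ℝ | t ≤ 0 ∧ x + t • (y - x) ∈ D}
      = - sSup {t : ℝ | 0 ≤ t ∧ x + t • (-(y - x)) ∈ D} := by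
    rw [Real.sInf_def]
    congr 2
    ext t
    simp only [Set.mem_neg, Set.mem_setOf_eq, smul_neg, neg_smul, Left.neg_nonpos_iff]
  unfold hilbertDist
  rw [if_neg hxy]
  simp only
  rw [hs]
  set τ := sSup {t : ℝ | 0 ≤ t ∧ x + t • (y - x) ∈ D}
  set u := sSup {t : ℝ | 0 ≤ t ∧ x + t • (-(y - x)) ∈ D}
  have hτ : 1 < τ := h1 1 zero_le_one (by simpa using hy)
  have hu : 0 < u := k1 0 le_rfl (by simpa using hx)
  have e1 : M D x y = τ / (τ - 1) := M_eq hopen hconvex hy h2 h3 hτ rfl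
  have e2 : M D y x = (1 + u) / (1 + u - 1) := by
    refine M_eq hopen hconvex hx k2 k3 (by linarith) ?_
    module
  have n1 : ‖x + τ • (y - x) - x‖ = τ * ‖y - x‖ := by
    rw [add_sub_cancel_left, norm_smul, Real.norm_eq_abs, abs_of_pos (by linarith)]
  have n2 : ‖x + τ • (y - x) - y‖ = (τ - 1) * ‖y - x‖ := by
    have : x + τ • (y - x) - y = (τ - 1) • (y - x) := by module
    rw [this, norm_smul, Real.norm_eq_abs, abs_of_pos (by linarith)]
  have n3 : ‖x + (-u) • (y - x) - x‖ = u * ‖y - x‖ := by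
    rw [add_sub_cancel_left, norm_smul, Real.norm_eq_abs, abs_neg, abs_of_pos (by linarith)]
  have n4 : ‖x + (-u) • (y - x) - y‖ = (1 + u) * ‖y - x‖ := by
    have : x + (-u) • (y - x) - y = (-(1 + u)) • (y - x) := by module
    rw [this, norm_smul, Real.norm_eq_abs, abs_neg, abs_of_pos (by linarith)]
  have hτ' : 0 < τ - 1 := by linarith
  rw [n1, n2, n3, n4, e1, e2, ← Real.log_mul (by positivity)
    (by rw [add_sub_cancel_left]; positivity)]
  congr 1
  rw [add_sub_cancel_left]
  field_simp

/-- Continuity of the distance in the second variable, at interior points. -/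
lemma tendsto_interior (hopen : IsOpen D) (hbdd : Bornology.IsBounded D) (hconvex : Convex ℝ D)
    {x p : EuclideanSpace ℝ (Fin N)} (hx : x ∈ D) (hp : p ∈ D)
    {z : ℕ → EuclideanSpace ℝ (Fin N)} (hz : ∀ k, z k ∈ D) (hlim : Tendsto z atTop (𝓝 p)) :
    Tendsto (fun k => hilbertDist D x (z k)) atTop (𝓝 (hilbertDist D x p)) := by
  have hM1 : Tendsto (fun k => M D (z k) p) atTop (𝓝 1) := by
    have := ((M_cont hopen hp).tendsto p).comp hlim
    rwa [M_self hopen hp] at this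
  obtain ⟨L, hL, hlip⟩ := lip hopen hp
  have hd : Tendsto (fun k => L * ‖p - z k‖) atTop (𝓝 0) := by
    have h1 : Tendsto (fun k => L * ‖p - z k‖) atTop (𝓝 (L * ‖p - p‖)) :=
      ((tendsto_const_nhds.sub hlim).norm).const_mul L
    simpa using h1
  have hinv : Tendsto (fun k => (1 - L * ‖p - z k‖)⁻¹) atTop (𝓝 1) := by
    have : Tendsto (fun k => (1 - L * ‖p - z k‖)⁻¹) atTop (𝓝 (1 - 0)⁻¹) :=
      (tendsto_const_nhds.sub hd).inv₀ (by norm_num)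
    simpa using this
  have hM2 : Tendsto (fun k => M D p (z k)) atTop (𝓝 1) := by
    refine tendsto_of_tendsto_of_tendsto_of_le_of_le' tendsto_const_nhds hinv
      (Eventually.of_forall fun k => one_le_M hopen (hz k) p) ?_
    filter_upwards [hd.eventually (gt_mem_nhds (zero_lt_one))] with k hk
    apply M_le (hz k)
    intro f hf
    have h1 := hlip f hf p (z k)
    have h2 : 0 < 1 - L * ‖p - z k‖ := by linarith
    rw [inv_mul_eq_div, le_div_iff₀ h2]
    linarith
  have hM3 : Tendsto (fun k => M D (z k) x) atTop (𝓝 (M D p x)) :=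
    ((M_cont hopen hx).tendsto p).comp hlim
  have hM4 : Tendsto (fun k => M D x (z k)) atTop (𝓝 (M D x p)) := by
    have hlow : Tendsto (fun k => M D x p / M D (z k) p) atTop (𝓝 (M D x p / 1)) :=
      tendsto_const_nhds.div hM1 one_ne_zero
    have hup : Tendsto (fun k => M D x p * M D p (z k)) atTop (𝓝 (M D x p * 1)) :=
      hM2.const_mul _
    rw [div_one] at hlow
    rw [mul_one] at hup
    refine tendsto_of_tendsto_of_tendsto_of_le_of_le hlow hup (fun k => ?_) (fun k => ?_)
    · have h1 := one_le_M hopen hp (z k)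
      simp only
      rw [div_le_iff₀ (by linarith)]
      exact M_trans hopen (hz k) hp x
    · exact M_trans hopen hp (hz k) x
  have hne1 : M D x p ≠ 0 := by have := one_le_M hopen hp x; linarith
  have hne2 : M D p x ≠ 0 := by have := one_le_M hopen hx p; linarith
  rw [dist_eq_log hopen hbdd hconvex hx hp]
  refine ((hM4.log hne1).add (hM3.log hne2)).congr fun k => ?_
  rw [dist_eq_log hopen hbdd hconvex hx (hz k)]

lemma M_tendsto_atTop (hopen : IsOpen D) (hconvex : Convex ℝ D)
    {b p : EuclideanSpace ℝ (Fin N)} (hb : b ∈ D) (hp : p ∉ D)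
    {z : ℕ → EuclideanSpace ℝ (Fin N)} (hz : ∀ k, z k ∈ D) (hlim : Tendsto z atTop (𝓝 p)) :
    Tendsto (fun k => (M D b (z k))⁻¹) atTop (𝓝 0) := by
  obtain ⟨f, hf, hfp⟩ := support hopen hconvex hp
  have h1 : Tendsto (fun k => ev f (z k) / ev f b) atTop (𝓝 0) := by
    have := (((ev_cont f).tendsto p).comp hlim).div_const (ev f b)
    rw [hfp, zero_div] at this
    exact this
  refine tendsto_of_tendsto_of_tendsto_of_le_of_le tendsto_const_nhds h1 (fun k => ?_) (fun k => ?_)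
  · have := one_le_M hopen (hz k) b
    simp only
    positivity
  · have h2 := le_M' hopen (hz k) b hf
    have h3 := one_le_M hopen (hz k) b
    have h4 := hf b hb
    simp only
    rw [le_div_iff₀ h4, inv_mul_le_iff₀ (by linarith)]
    linarith

/-- The main upper bound along the segment from `p` to `b`. -/
lemma upper (hopen : IsOpen D) (hbdd : Bornology.IsBounded D) (hconvex : Convex ℝ D)
    {b p x : EuclideanSpace ℝ (Fin N)} (hb : b ∈ D) (hp : p ∉ D) (hx : x ∈ D)
    {s : ℝ} (hs : 0 < s) (hs1 : s ≤ 1) (hxs : x = p + s • (b - p))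
    {z : ℕ → EuclideanSpace ℝ (Fin N)} (hz : ∀ k, z k ∈ D) (hlim : Tendsto z atTop (𝓝 p))
    {a : ℝ} (ha : Tendsto (fun k => hilbertDist D x (z k) - hilbertDist D b (z k)) atTop (𝓝 a)) :
    a ≤ Real.log s + Real.log (M D p x) - Real.log (M D p b) := by
  obtain ⟨L, hL, hlip⟩ := lip hopen hb
  have hd : Tendsto (fun k => L * ‖p - z k‖) atTop (𝓝 0) := by
    have h1 : Tendsto (fun k => L * ‖p - z k‖) atTop (𝓝 (L * ‖p - p‖)) :=
      ((tendsto_const_nhds.sub hlim).norm).const_mul L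
    simpa using h1
  have hinf := M_tendsto_atTop hopen hconvex hb hp hz hlim
  have hpx : Tendsto (fun k => M D (z k) x) atTop (𝓝 (M D p x)) :=
    ((M_cont hopen hx).tendsto p).comp hlim
  have hpb : Tendsto (fun k => M D (z k) b) atTop (𝓝 (M D p b)) :=
    ((M_cont hopen hb).tendsto p).comp hlim
  have hne1 : M D p x ≠ 0 := by have := one_le_M hopen hx p; linarith
  have hne2 : M D p b ≠ 0 := by have := one_le_M hopen hb p; linarith
  have hg : Tendsto (fun k => s + ((M D b (z k))⁻¹ + L * ‖p - z k‖)) atTop (𝓝 s) := by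
    have := (hinf.add hd).const_add s
    simpa using this
  refine le_of_tendsto_of_tendsto' ha
    (((hg.log hs.ne').add (hpx.log hne1)).sub (hpb.log hne2)) fun k => ?_
  rw [dist_eq_log hopen hbdd hconvex hx (hz k), dist_eq_log hopen hbdd hconvex hb (hz k)]
  have m1 := one_le_M hopen (hz k) x
  have m2 := one_le_M hopen (hz k) b
  have m2' : 0 < M D b (z k) := by linarith
  have key : M D x (z k) ≤ (s + ((M D b (z k))⁻¹ + L * ‖p - z k‖)) * M D b (z k) := by
    apply M_le (hz k)
    intro f hf
    have f1 := hlip f hf p (z k)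
    have f2 := le_M' hopen (hz k) b hf
    have f3 := hf _ (hz k)
    have f4 := hf b hb
    have hc : 0 ≤ L * ‖p - z k‖ := by positivity
    have f5 : ev f p ≤ ev f (z k) + L * ‖p - z k‖ * (M D b (z k) * ev f (z k)) := by
      have := mul_le_mul_of_nonneg_left f2 hc
      linarith
    have f6 : 0 ≤ ev f (z k) + L * ‖p - z k‖ * (M D b (z k) * ev f (z k)) := by positivity
    have e : (s + ((M D b (z k))⁻¹ + L * ‖p - z k‖)) * M D b (z k) * ev f (z k)
        = s * (M D b (z k) * ev f (z k))
          + (ev f (z k) + L * ‖p - z k‖ * (M D b (z k) * ev f (z k))) := by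
      field_simp
    rw [e, hxs, ev_comb]
    have g1 := mul_le_mul_of_nonneg_left f2 hs.le
    have g2 := mul_le_mul_of_nonneg_left f5 (by linarith : 0 ≤ 1 - s)
    have g3 := mul_nonneg hs.le f6
    linarith
  have hc : 0 < s + ((M D b (z k))⁻¹ + L * ‖p - z k‖) := by positivity
  have := Real.log_le_log (by linarith) key
  rw [Real.log_mul hc.ne' m2'.ne'] at this
  linarith

lemma lower (hopen : IsOpen D) (hbdd : Bornology.IsBounded D) (hconvex : Convex ℝ D)
    {b p q x : EuclideanSpace ℝ (Fin N)} (hb : b ∈ D) (hp : p ∈ closure D) (hx : x ∈ D)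
    {s : ℝ} (hs : 0 < s) (hs1 : s ≤ 1) (hxs : x = p + s • (b - p))
    {z : ℕ → EuclideanSpace ℝ (Fin N)} (hz : ∀ k, z k ∈ D) (hlim : Tendsto z atTop (𝓝 q))
    {a : ℝ} (ha : Tendsto (fun k => hilbertDist D x (z k) - hilbertDist D b (z k)) atTop (𝓝 a)) :
    Real.log s + Real.log (M D q x) - Real.log (M D q b) ≤ a := by
  have hpx : Tendsto (fun k => M D (z k) x) atTop (𝓝 (M D q x)) :=
    ((M_cont hopen hx).tendsto q).comp hlim
  have hpb : Tendsto (fun k => M D (z k) b) atTop (𝓝 (M D q b)) :=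
    ((M_cont hopen hb).tendsto q).comp hlim
  have hne1 : M D q x ≠ 0 := by have := one_le_M hopen hx q; linarith
  have hne2 : M D q b ≠ 0 := by have := one_le_M hopen hb q; linarith
  refine le_of_tendsto_of_tendsto'
    (((hpx.log hne1).const_add (Real.log s)).sub (hpb.log hne2)) ha fun k => ?_
  rw [dist_eq_log hopen hbdd hconvex hx (hz k), dist_eq_log hopen hbdd hconvex hb (hz k)]
  have m1 := one_le_M hopen (hz k) x
  have m2 := one_le_M hopen (hz k) b
  have key : M D b (z k) ≤ s⁻¹ * M D x (z k) := by
    apply M_le (hz k)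
    intro f hf
    have f1 := le_M' hopen (hz k) x hf
    have f2 := ev_nonneg hf hp
    rw [hxs, ev_comb, ← hxs] at f1
    rw [mul_assoc, inv_mul_eq_div, le_div_iff₀ hs]
    nlinarith
  have := Real.log_le_log (by linarith) key
  rw [Real.log_mul (by positivity) (by linarith), Real.log_inv] at this
  linarith

lemma exists_sep (hbdd : Bornology.IsBounded D) {p q : EuclideanSpace ℝ (Fin N)}
    (hpq : p ≠ q) : ∃ f ∈ PA D, 0 < ev f p ∧ ev f p < ev f q := by
  obtain ⟨R, hR⟩ := hbdd.exists_norm_le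
  let l : EuclideanSpace ℝ (Fin N) →L[ℝ] ℝ := innerSL ℝ (q - p)
  refine ⟨(l, ‖l‖ * |R| + ‖l‖ * ‖p‖ + 1), fun x hx => ?_, ?_, ?_⟩
  · have h1 := neg_le_of_abs_le (l.le_opNorm x)
    have h2 : ‖l‖ * ‖x‖ ≤ ‖l‖ * |R| := by
      gcongr; exact (hR x hx).trans (le_abs_self R)
    have : 0 ≤ ‖l‖ * ‖p‖ := by positivity
    simp only [ev]; linarith
  · have h1 := neg_le_of_abs_le (l.le_opNorm p)
    have : 0 ≤ ‖l‖ * |R| := by positivity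
    simp only [ev]; linarith
  · have h1 : l q - l p = ‖q - p‖ ^ 2 := by
      rw [← map_sub]; exact real_inner_self_eq_norm_sq (q - p)
    have h2 : 0 < ‖q - p‖ := norm_pos_iff.2 (sub_ne_zero.2 hpq.symm)
    have : 0 < ‖q - p‖ ^ 2 := by positivity
    simp only [ev]; linarith

lemma compare (hopen : IsOpen D) (hbdd : Bornology.IsBounded D) (hconvex : Convex ℝ D)
    {b p q : EuclideanSpace ℝ (Fin N)} (hb : b ∈ D) (hp : p ∈ closure D) (hp' : p ∉ D)
    (hpq : p ≠ q) {h : EuclideanSpace ℝ (Fin N) → ℝ}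
    {z z' : ℕ → EuclideanSpace ℝ (Fin N)} (hz : ∀ k, z k ∈ D) (hlim : Tendsto z atTop (𝓝 p))
    (hz' : ∀ k, z' k ∈ D) (hlim' : Tendsto z' atTop (𝓝 q))
    (ha : ∀ x ∈ D,
      Tendsto (fun k => hilbertDist D x (z k) - hilbertDist D b (z k)) atTop (𝓝 (h x)))
    (ha' : ∀ x ∈ D,
      Tendsto (fun k => hilbertDist D x (z' k) - hilbertDist D b (z' k)) atTop (𝓝 (h x))) :
    Real.log (M D p b) < Real.log (M D q b) := by
  obtain ⟨f, hf, hfp, hfpq⟩ := exists_sep hbdd hpq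
  have hfq : 0 < ev f q := hfp.trans hfpq
  have main : ∀ s : ℝ, 0 < s → s < 1 → Real.log (M D p b) - Real.log (M D q b)
      ≤ - Real.log (1 - s) - (Real.log (ev f q) - Real.log (ev f (p + s • (b - p)))) := by
    intro s hs hs1
    have hx : p + s • (b - p) ∈ D := by
      have := hconvex.add_smul_sub_mem_interior' hp (by rwa [hopen.interior_eq]) ⟨hs, hs1.le⟩
      rwa [hopen.interior_eq] at this
    have h1 := upper hopen hbdd hconvex hb hp' hx hs hs1.le rfl hz hlim (ha _ hx)
    have h2 := lower hopen hbdd hconvex hb hp hx hs hs1.le rfl hz' hlim' (ha' _ hx)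
    have h3 : M D p (p + s • (b - p)) ≤ (1 - s)⁻¹ := by
      apply M_le hx
      intro g hg
      have := hg b hb
      rw [ev_comb, inv_mul_eq_div, le_div_iff₀ (by linarith)]
      nlinarith
    have h4 := Real.log_le_log (by have := one_le_M hopen hx p; linarith) h3
    rw [Real.log_inv] at h4
    have h5 := le_M hopen hx q hf
    have h6 := hf _ hx
    have h7 := Real.log_le_log (by positivity) h5
    rw [Real.log_div hfq.ne' h6.ne'] at h7
    linarith
  have hl : Tendsto (fun s : ℝ => - Real.log (1 - s)
      - (Real.log (ev f q) - Real.log (ev f (p + s • (b - p))))) (𝓝[>] 0)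
      (𝓝 (- Real.log (1 - 0) - (Real.log (ev f q) - Real.log (ev f (p + (0 : ℝ) • (b - p)))))) := by
    apply Tendsto.mono_left _ nhdsWithin_le_nhds
    have c1 : ContinuousAt (fun s : ℝ => Real.log (1 - s)) 0 :=
      ContinuousAt.log (by fun_prop) (by norm_num)
    have c2 : ContinuousAt (fun s : ℝ => Real.log (ev f (p + s • (b - p)))) 0 := by
      refine ContinuousAt.log ((ev_cont f).comp (by fun_prop)).continuousAt ?_
      simpa using hfp.ne'
    exact (c1.neg.sub (continuousAt_const.sub c2)).tendsto
  have hle := ge_of_tendsto hl (b := Real.log (M D p b) - Real.log (M D q b)) (by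
    filter_upwards [Ioo_mem_nhdsGT (zero_lt_one (α := ℝ))] with s hs
    exact main s hs.1 hs.2)
  have := Real.log_lt_log hfp hfpq
  simp at hle
  linarith

end

end HilbHoro

/-- Convergence to the horofunction boundary of a Hilbert geometry implies Euclidean
convergence to the boundary: if `zₙ ∈ D` and `φ_{zₙ} = d_H(·,zₙ) - d_H(b,zₙ)`
converges uniformly on compact subsets of `D` to a function `h` that is not equal
(on `D`) to any `φ_z` with `z ∈ D`, then `zₙ` converges in `ℝᴺ` to a point of the
Euclidean boundary `∂D`. -/
theorem hilbert_horofunction_convergence_to_boundary (N : ℕ) (hN : 1 ≤ N)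
    (D : Set (EuclideanSpace ℝ (Fin N))) (hne : D.Nonempty) (hopen : IsOpen D)
    (hbdd : Bornology.IsBounded D) (hconvex : Convex ℝ D)
    (b : EuclideanSpace ℝ (Fin N)) (hb : b ∈ D)
    (z : ℕ → EuclideanSpace ℝ (Fin N)) (hz : ∀ k, z k ∈ D)
    (h : EuclideanSpace ℝ (Fin N) → ℝ)
    (hconv : ∀ K ⊆ D, IsCompact K →
      TendstoUniformlyOn (fun k x => hilbertDist D x (z k) - hilbertDist D b (z k))
        h atTop K)
    (hnot : ∀ w ∈ D,
      ¬ Set.EqOn h (fun x => hilbertDist D x w - hilbertDist D b w) D) :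
    ∃ p ∈ frontier D, Tendsto z atTop (nhds p) := by
  have hpt : ∀ x ∈ D, Tendsto (fun k => hilbertDist D x (z k) - hilbertDist D b (z k))
      atTop (𝓝 (h x)) := fun x hx =>
    (hconv {x} (by simpa using hx) isCompact_singleton).tendsto_at rfl
  have hcomp : IsCompact (closure D) := hbdd.isCompact_closure
  -- every limit of a subsequence lies outside `D`
  have hout : ∀ p, ∀ ns : ℕ → ℕ, Tendsto ns atTop atTop →
      Tendsto (fun k => z (ns k)) atTop (𝓝 p) → p ∉ D := by
    intro p ns hns hlim hp
    refine hnot p hp fun x hx => ?_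
    have h1 := (hpt x hx).comp hns
    have h2 := (HilbHoro.tendsto_interior hopen hbdd hconvex hx hp (fun k => hz (ns k)) hlim).sub
      (HilbHoro.tendsto_interior hopen hbdd hconvex hb hp (fun k => hz (ns k)) hlim)
    exact tendsto_nhds_unique h1 h2
  obtain ⟨p, hpcl, ns, hns, hlim⟩ := hcomp.tendsto_subseq (fun k => subset_closure (hz k))
  have hpD := hout p ns hns.tendsto_atTop hlim
  refine ⟨p, ⟨hpcl, by rwa [hopen.interior_eq]⟩, ?_⟩
  apply tendsto_of_subseq_tendsto
  intro ms hms
  obtain ⟨q, hqcl, ks, hks, hlim'⟩ :=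
    hcomp.tendsto_subseq (fun k => subset_closure (hz (ms k)))
  have hmk := hms.comp hks.tendsto_atTop
  have hqD := hout q _ hmk hlim'
  refine ⟨ks, ?_⟩
  by_cases hpq : p = q
  · subst hpq; exact hlim'
  exfalso
  have a1 : ∀ x ∈ D, Tendsto (fun k => hilbertDist D x ((z ∘ ns) k)
      - hilbertDist D b ((z ∘ ns) k)) atTop (𝓝 (h x)) :=
    fun x hx => (hpt x hx).comp hns.tendsto_atTop
  have a2 : ∀ x ∈ D, Tendsto (fun k => hilbertDist D x (((fun k => z (ms k)) ∘ ks) k)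
      - hilbertDist D b (((fun k => z (ms k)) ∘ ks) k)) atTop (𝓝 (h x)) :=
    fun x hx => (hpt x hx).comp hmk
  have c1 := HilbHoro.compare hopen hbdd hconvex hb hpcl hpD hpq (fun k => hz _) hlim
    (fun k => hz _) hlim' a1 a2
  have c2 := HilbHoro.compare hopen hbdd hconvex hb hqcl hqD (Ne.symm hpq) (fun k => hz _) hlim'
    (fun k => hz _) hlim a2 a1
  exact lt_asymm c1 c2
end

section
/- Monotonicity of the policy-improvement step: Let Y and Z be finite nonempty types, c : Y → Z → ℝ, λ, λ' : Y → ℝ, and T, T' : Z → Y → ℝ. Assume λ'(k) ≤ λ(k) for all k ∈ Y. Assume further that for every i ∈ Y there exist j̄ ∈ Z attaining the minimum min_{j∈Z} ( −c(i,j) + max_{k∈Y} (λ(k) + T(j,k)) ) and k̄ ∈ Y attaining the maximum max_{k∈Y} (λ(k) + T(j̄,k)), such that: (feasibility) λ(k̄) + T'(j̄, k̄) ≥ λ(k) + T'(j̄, k) for all k ∈ Y, and (improvement) T'(j̄, k̄) ≤ T(j̄, k̄). Then for every i ∈ Y, min_{j∈Z} ( −c(i,j) + max_{k∈Y} (λ'(k)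 + T'(j,k)) ) ≤ min_{j∈Z} ( −c(i,j) + max_{k∈Y} (λ(k) + T(j,k)) ). -/
/-- Monotonicity of the policy-improvement step: if `λ' ≤ λ` pointwise, and for every
`i` there exist `j̄` attaining `min_j (-c(i,j) + max_k (λ(k) + T(j,k)))` and `k̄`
attaining `max_k (λ(k) + T(j̄,k))` such that the feasibility condition
`λ(k̄) + T'(j̄,k̄) ≥ λ(k) + T'(j̄,k)` for all `k` and the improvement condition
`T'(j̄,k̄) ≤ T(j̄,k̄)` hold, then for every `i`,
`min_j (-c(i,j) + max_k (λ'(k) + T'(j,k))) ≤ min_j (-c(i,j) + max_k (λ(k) + T(j,k)))`. -/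
theorem policy_improvement_monotone (Y Z : Type*) [Fintype Y] [Fintype Z]
    [Nonempty Y] [Nonempty Z]
    (c : Y → Z → ℝ) (lam lam' : Y → ℝ) (T T' : Z → Y → ℝ)
    (hle : ∀ k, lam' k ≤ lam k)
    (hstep : ∀ i : Y, ∃ (jbar : Z) (kbar : Y),
      (-c i jbar + Finset.univ.sup' Finset.univ_nonempty (fun k => lam k + T jbar k) =
        Finset.univ.inf' Finset.univ_nonempty
          (fun j => -c i j + Finset.univ.sup' Finset.univ_nonempty
            (fun k => lam k + T j k))) ∧
      (lam kbar + T jbar kbar =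
        Finset.univ.sup' Finset.univ_nonempty (fun k => lam k + T jbar k)) ∧
      (∀ k : Y, lam k + T' jbar k ≤ lam kbar + T' jbar kbar) ∧
      T' jbar kbar ≤ T jbar kbar) :
    ∀ i : Y,
      Finset.univ.inf' Finset.univ_nonempty
          (fun j => -c i j + Finset.univ.sup' Finset.univ_nonempty
            (fun k => lam' k + T' j k)) ≤
        Finset.univ.inf' Finset.univ_nonempty
          (fun j => -c i j + Finset.univ.sup' Finset.univ_nonempty
            (fun k => lam k + T j k)) := by
  intro i
  obtain ⟨j, k, h1, h2, h3, h4⟩ := hstep i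
  rw [← h1, ← h2]
  refine (Finset.inf'_le _ (Finset.mem_univ j)).trans ?_
  have h : Finset.univ.sup' Finset.univ_nonempty (fun k => lam' k + T' j k)
      ≤ lam k + T j k := by
    refine Finset.sup'_le _ _ fun m _ => ?_
    have := h3 m
    have := hle m
    linarith
  linarith
end
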